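/- arXiv:2312.14840 — 4 statements merged into one kernel-verified Lean document; each statement's English description precedes it below -/
import Mathlib

section
/- Fix θ > 0, α > −1, a positive integer n, and a continuous function V : [0,∞) → ℝ with V(x)/log x → +∞ as x → +∞. Then for every j ∈ ℕ there exists a unique monic polynomial p_{n,j} of degree j such that ∫₀^∞ p_{n,j}(x)·x^{θk+α}·e^{−nV(x)} dx = 0 for every integer 0 ≤ k < j, and a unique monic polynomial q_{n,j} of degree j such that ∫₀^∞ x^k·q_{n,j}(x^θ)·x^α·e^{−nV(x)} dx = 0 for every integer 0 ≤ k < j; moreover κ_{n,j} := ∫₀^∞ p_{n,j}(x)·q_{n,j}(x^θ)·x^α·e^{−nV(x)} dx > 0. Consequently ∫₀^∞ p_{n,j}(x)·q_{n,k}(x^θ)·x^α·e^{−nV(x)} dx = κ_{n,j}·δ_{jk} for all j, k ∈ ℕ. -/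
open MeasureTheory Filter Set

/-- The orthogonality conditions defining the first family of Muttalib-Borodin
biorthogonal polynomials: `p` is monic of degree `j` and
`∫₀^∞ p(x) x^(θk+α) e^(-n V(x)) dx = 0` for all `0 ≤ k < j`. -/
def PCond (θ α : ℝ) (n : ℕ) (V : ℝ → ℝ) (j : ℕ) (p : Polynomial ℝ) : Prop :=
  p.Monic ∧ p.natDegree = j ∧
    ∀ k : ℕ, k < j →
      ∫ x in Set.Ioi (0:ℝ),
        p.eval x * x ^ (θ * (k : ℝ) + α) * Real.exp (-(n : ℝ) * V x) = 0

/-- The orthogonality conditions defining the second family of Muttalib-Borodin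
biorthogonal polynomials: `q` is monic of degree `j` and
`∫₀^∞ x^k q(x^θ) x^α e^(-n V(x)) dx = 0` for all `0 ≤ k < j`. -/
def QCond (θ α : ℝ) (n : ℕ) (V : ℝ → ℝ) (j : ℕ) (q : Polynomial ℝ) : Prop :=
  q.Monic ∧ q.natDegree = j ∧
    ∀ k : ℕ, k < j →
      ∫ x in Set.Ioi (0:ℝ),
        x ^ (k : ℕ) * q.eval (x ^ θ) * x ^ α * Real.exp (-(n : ℝ) * V x) = 0

/-- The pairing `∫₀^∞ p(x) q(x^θ) x^α e^(-n V(x)) dx`. -/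
noncomputable def kappaInt (θ α : ℝ) (n : ℕ) (V : ℝ → ℝ) (p q : Polynomial ℝ) : ℝ :=
  ∫ x in Set.Ioi (0:ℝ),
    p.eval x * q.eval (x ^ θ) * x ^ α * Real.exp (-(n : ℝ) * V x)

open Polynomial in
lemma mb_sign (θ : ℝ) (hθ : 0 < θ) : ∀ (d : ℕ) (p : Polynomial ℝ), p.natDegree = d → p ≠ 0 →
    ∃ q : Polynomial ℝ, q.Monic ∧ q.natDegree ≤ d ∧
      ∀ x : ℝ, 0 < x → 0 ≤ p.leadingCoeff * (p.eval x * q.eval (x ^ θ)) := by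
  intro d
  induction d with
  | zero =>
    intro p hd hp
    refine ⟨1, monic_one, by simp, ?_⟩
    intro x hx
    rw [Polynomial.eq_C_of_natDegree_eq_zero hd]
    simp [mul_self_nonneg]
  | succ d ih =>
    intro p hd hp
    by_cases h : ∃ a : ℝ, 0 < a ∧ p.IsRoot a
    · obtain ⟨a, ha, hr⟩ := h
      obtain ⟨r, rfl⟩ := Polynomial.dvd_iff_isRoot.mpr hr
      have hr0 : r ≠ 0 := by rintro rfl; simp at hp
      have hdr : r.natDegree = d := by
        rw [Polynomial.natDegree_mul (X_sub_C_ne_zero a) hr0, natDegree_X_sub_C] at hd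
        omega
      obtain ⟨q, hq, hqd, hpos⟩ := ih r hdr hr0
      refine ⟨(X - C (a ^ θ)) * q, (monic_X_sub_C _).mul hq, ?_, ?_⟩
      · rw [Polynomial.natDegree_mul (X_sub_C_ne_zero _) hq.ne_zero, natDegree_X_sub_C]
        omega
      · intro x hx
        have h1 := hpos x hx
        have h2 : 0 ≤ (x - a) * (x ^ θ - a ^ θ) := by
          rcases le_total a x with h | h
          · exact mul_nonneg (by linarith)
              (by linarith [Real.rpow_le_rpow ha.le h hθ.le])
          · exact mul_nonneg_of_nonpos_of_nonpos (by linarith)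
              (by linarith [Real.rpow_le_rpow hx.le h hθ.le])
        have := mul_nonneg h2 h1
        simp only [leadingCoeff_mul, leadingCoeff_X_sub_C, one_mul, eval_mul, eval_sub, eval_X,
          eval_C]
        calc (0:ℝ) ≤ _ := this
          _ = _ := by ring
    · push Not at h
      refine ⟨1, monic_one, by simp, ?_⟩
      intro x hx
      simp only [eval_one, mul_one]
      by_contra hneg
      push Not at hneg
      have hlc : p.leadingCoeff ≠ 0 := leadingCoeff_ne_zero.mpr hp
      have ht : Tendsto (fun x => (C p.leadingCoeff * p).eval x) atTop atTop := by
        apply Polynomial.tendsto_atTop_of_leadingCoeff_nonneg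
        · rw [Polynomial.degree_C_mul hlc]
          apply Polynomial.natDegree_pos_iff_degree_pos.mp
          omega
        · simp [mul_self_nonneg]
      obtain ⟨y, hy, hxy⟩ := ((ht.eventually_ge_atTop 0).and (eventually_ge_atTop x)).exists
      have hc : ContinuousOn (fun x => (C p.leadingCoeff * p).eval x) (Set.Icc x y) :=
        (Polynomial.continuous _).continuousOn
      have hm := intermediate_value_Icc hxy hc
      obtain ⟨z, hz, hz0⟩ := hm (show (0:ℝ) ∈ _ from ⟨by simpa using hneg.le, hy⟩)
      have : p.eval z = 0 := by simpa [hlc, hp] using hz0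
      exact h z (lt_of_lt_of_le hx hz.1) this

lemma mb_integrable (n : ℕ) (hn : 0 < n)
    (V : ℝ → ℝ) (hVcont : ContinuousOn V (Set.Ici 0))
    (hVgrowth : Tendsto (fun x => V x / Real.log x) atTop atTop) (a : ℝ) (ha : -1 < a) :
    IntegrableOn (fun x : ℝ => x ^ a * Real.exp (-(n : ℝ) * V x)) (Ioi 0) := by
  have hn1 : (1:ℝ) ≤ n := by exact_mod_cast hn
  obtain ⟨R, hRV, hR⟩ := ((eventually_forall_ge_atTop.mpr
    (hVgrowth.eventually_ge_atTop (|a| + 2))).and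
    (eventually_ge_atTop 2)).exists
  have hmeas : ContinuousOn (fun x : ℝ => x ^ a * Real.exp (-(n : ℝ) * V x)) (Ioi 0) := by
    apply ContinuousOn.mul
    · exact fun x hx => (Real.continuousAt_rpow_const x a
        (Or.inl (ne_of_gt hx))).continuousWithinAt
    · exact Real.continuous_exp.comp_continuousOn
        (continuousOn_const.mul (hVcont.mono Ioi_subset_Ici_self))
  have hU : Ioi (0:ℝ) = Ioc 0 R ∪ Ioi R := (Ioc_union_Ioi_eq_Ioi (by linarith)).symm
  have hm := hmeas.aestronglyMeasurable (μ := volume) measurableSet_Ioi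
  rw [hU]
  apply IntegrableOn.union
  · have hcE : ContinuousOn (fun x : ℝ => Real.exp (-(n : ℝ) * V x)) (Icc 0 R) :=
      Real.continuous_exp.comp_continuousOn
        (continuousOn_const.mul (hVcont.mono Icc_subset_Ici_self))
    obtain ⟨M, hM⟩ := isCompact_Icc.exists_bound_of_continuousOn hcE
    have hi : IntegrableOn (fun x : ℝ => M * x ^ a) (Ioc 0 R) := by
      apply Integrable.const_mul
      have := intervalIntegral.intervalIntegrable_rpow' (a := 0) (b := R) ha
      rwa [intervalIntegrable_iff_integrableOn_Ioc_of_le (by linarith)] at this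
    apply Integrable.mono' hi (hm.mono_measure (Measure.restrict_mono Ioc_subset_Ioi_self le_rfl))
    filter_upwards [ae_restrict_mem measurableSet_Ioc] with x hx
    have h1 := hM x ⟨hx.1.le, hx.2⟩
    have h2 : 0 ≤ x ^ a := Real.rpow_nonneg hx.1.le a
    rw [norm_mul, Real.norm_of_nonneg h2, mul_comm]
    exact mul_le_mul_of_nonneg_right h1 h2
  · have hi : IntegrableOn (fun x : ℝ => x ^ (-2:ℝ)) (Ioi R) :=
      integrableOn_Ioi_rpow_of_lt (by norm_num) (by linarith)
    apply Integrable.mono' hi (hm.mono_measure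
      (Measure.restrict_mono (Ioi_subset_Ioi (by linarith)) le_rfl))
    filter_upwards [ae_restrict_mem measurableSet_Ioi] with x hx
    have hx : R < x := hx
    have hx0 : 0 < x := by linarith
    have hl : 0 < Real.log x := Real.log_pos (by linarith)
    have h1 := hRV x hx.le
    rw [le_div_iff₀ hl] at h1
    rw [Real.norm_of_nonneg (by positivity), Real.rpow_def_of_pos hx0, Real.rpow_def_of_pos hx0,
      ← Real.exp_add]
    apply Real.exp_le_exp.mpr
    have h0 : 0 ≤ V x := le_trans (by positivity) h1
    have h3 : V x ≤ n * V x := by nlinarith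
    have h4 : a * Real.log x ≤ |a| * Real.log x := mul_le_mul_of_nonneg_right (le_abs_self a) hl.le
    nlinarith

open Polynomial in
/-- Abstract existence and uniqueness. -/
lemma mb_abstract (B : ℝ[X] →ₗ[ℝ] ℝ[X] →ₗ[ℝ] ℝ)
    (H : ∀ p : ℝ[X], p ≠ 0 → ∃ q : ℝ[X], q.natDegree ≤ p.natDegree ∧ B p q ≠ 0) (j : ℕ) :
    ∃! p : ℝ[X], p.Monic ∧ p.natDegree = j ∧ ∀ k < j, B p (X ^ k) = 0 := by
  have ext0 : ∀ p : ℝ[X], (∀ k < j, B p (X ^ k) = 0) → ∀ q : ℝ[X], q.degree < j → B p q = 0 := by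
    intro p hp q hq
    by_cases hq0 : q = 0
    · simp [hq0]
    have hq' := (natDegree_lt_iff_degree_lt hq0).mpr hq
    rw [q.as_sum_range_C_mul_X_pow, map_sum]
    refine Finset.sum_eq_zero fun i hi => ?_
    rw [← smul_eq_C_mul, map_smul, hp i (by have := Finset.mem_range.mp hi; omega), smul_zero]
  have inj : ∀ p : ℝ[X], p.degree < j → (∀ k < j, B p (X ^ k) = 0) → p = 0 := by
    intro p hp hk
    by_contra h0
    obtain ⟨q, hq, hB⟩ := H p h0
    refine hB (ext0 p hk q ?_)
    have := (natDegree_lt_iff_degree_lt h0).mpr hp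
    exact lt_of_le_of_lt degree_le_natDegree (by exact_mod_cast lt_of_le_of_lt hq this)
  let T : degreeLT ℝ j →ₗ[ℝ] (Fin j → ℝ) :=
    LinearMap.pi fun k => (B.flip (X ^ (k : ℕ))).comp (degreeLT ℝ j).subtype
  have hTi : Function.Injective T := by
    rw [← LinearMap.ker_eq_bot, LinearMap.ker_eq_bot']
    rintro ⟨p, hp⟩ h
    ext1
    refine inj p (mem_degreeLT.mp hp) fun k hk => ?_
    exact congrFun h ⟨k, hk⟩
  have hTs : Function.Surjective T := by
    have e := degreeLTEquiv ℝ j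
    have : FiniteDimensional ℝ (degreeLT ℝ j) := e.symm.finiteDimensional
    exact (LinearMap.injective_iff_surjective_of_finrank_eq_finrank e.finrank_eq).mp hTi
  obtain ⟨⟨r, hr⟩, hT⟩ := hTs fun k => - B (X ^ j) (X ^ (k : ℕ))
  rw [mem_degreeLT] at hr
  refine ⟨X ^ j + r, ⟨monic_X_pow_add hr, ?_, ?_⟩, ?_⟩
  · exact natDegree_eq_of_degree_eq_some (by
      rw [degree_add_eq_left_of_degree_lt] <;> simp [hr])
  · intro k hk
    have : B r (X ^ k) = - B (X ^ j) (X ^ k) := congrFun hT ⟨k, hk⟩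
    simp [this]
  · rintro p ⟨hm, hd, hk⟩
    have hlt : (p - X ^ j - r).degree < (j : WithBot ℕ) := by
      apply lt_of_le_of_lt (degree_sub_le _ _)
      refine max_lt ?_ hr
      have hpd : p.degree = j := by rw [degree_eq_natDegree hm.ne_zero, hd]
      rw [← hpd]
      apply degree_sub_lt_left
      · rw [hpd]; simp
      · exact hm.ne_zero
      · simp [hm.leadingCoeff]
    have h0 := inj _ hlt (fun k hk' => by
      have : B r (X ^ k) = - B (X ^ j) (X ^ k) := congrFun hT ⟨k, hk'⟩
      simp [this, hk k hk'])
    linear_combination h0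

open Polynomial in
lemma mb_int (θ α : ℝ) (hθ : 0 < θ) (hα : -1 < α)
    (n : ℕ) (hn : 0 < n)
    (V : ℝ → ℝ) (hVcont : ContinuousOn V (Set.Ici 0))
    (hVgrowth : Tendsto (fun x => V x / Real.log x) atTop atTop) (p q : ℝ[X]) : IntegrableOn (fun x : ℝ =>
    p.eval x * q.eval (x ^ θ) * x ^ α * Real.exp (-(n : ℝ) * V x)) (Ioi 0) := by
  induction p using Polynomial.induction_on' with
  | add p p' h h' =>
    refine (h.add h').congr (Eventually.of_forall fun x => ?_)
    simp only [eval_add, Pi.add_apply]; ring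
  | monomial m a =>
    induction q using Polynomial.induction_on' with
    | add p p' h h' =>
      refine (h.add h').congr (Eventually.of_forall fun x => ?_)
      simp only [eval_add, Pi.add_apply]; ring
    | monomial k b =>
      have hk : 0 ≤ (m:ℝ) + θ * k := by positivity
      refine IntegrableOn.congr_fun ((mb_integrable n hn V hVcont hVgrowth (m + θ * k + α)
        (by linarith)).const_mul (a * b)) ?_ measurableSet_Ioi
      intro x hx
      have hx : 0 < x := hx
      simp only [eval_monomial]
      rw [Real.rpow_add hx, Real.rpow_add hx, Real.rpow_natCast, Real.rpow_mul hx.le,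
        Real.rpow_natCast]
      ring


open Polynomial in
lemma mb_pos (θ α : ℝ) (hθ : 0 < θ) (hα : -1 < α)
    (n : ℕ) (hn : 0 < n)
    (V : ℝ → ℝ) (hVcont : ContinuousOn V (Set.Ici 0))
    (hVgrowth : Tendsto (fun x => V x / Real.log x) atTop atTop) (p : ℝ[X]) (hp : p ≠ 0) :
    ∃ q : ℝ[X], q.Monic ∧ q.natDegree ≤ p.natDegree ∧
      0 < p.leadingCoeff * kappaInt θ α n V p q := by
  obtain ⟨q, hq, hqd, hpos⟩ := mb_sign θ hθ _ p rfl hp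
  refine ⟨q, hq, hqd, ?_⟩
  have hInt := (mb_int θ α hθ hα n hn V hVcont hVgrowth p q).const_mul p.leadingCoeff
  rw [kappaInt, ← integral_const_mul]
  have hnn : 0 ≤ᵐ[volume.restrict (Ioi (0:ℝ))] fun x : ℝ => p.leadingCoeff *
      (p.eval x * q.eval (x ^ θ) * x ^ α * Real.exp (-(n : ℝ) * V x)) := by
    filter_upwards [ae_restrict_mem measurableSet_Ioi] with x hx
    have hx : 0 < x := hx
    have h1 := mul_nonneg (hpos x hx)
      (mul_nonneg (Real.rpow_nonneg hx.le α) (Real.exp_nonneg (-(n : ℝ) * V x)))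
    simp only [Pi.zero_apply]
    calc (0:ℝ) ≤ _ := h1
      _ = _ := by ring
  rw [integral_pos_iff_support_of_nonneg_ae hnn hInt]
  have e1 := p.eventually_atTop_not_isRoot hp
  have e2 := (tendsto_rpow_atTop hθ).eventually (q.eventually_atTop_not_isRoot hq.ne_zero)
  obtain ⟨R, hR⟩ := eventually_atTop.mp ((e1.and e2).and (eventually_gt_atTop 0))
  have hR0 : 0 < R := (hR R le_rfl).2
  have hsub : Ioi R ⊆ (Function.support fun x : ℝ => p.leadingCoeff *
      (p.eval x * q.eval (x ^ θ) * x ^ α * Real.exp (-(n : ℝ) * V x))) ∩ Ioi 0 := by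
    intro x hx
    obtain ⟨⟨h1, h2⟩, h3⟩ := hR x (le_of_lt hx)
    refine ⟨?_, h3⟩
    have h4 := (Real.rpow_pos_of_pos h3 α).ne'
    simp only [Function.mem_support]
    exact mul_ne_zero (leadingCoeff_ne_zero.mpr hp)
      (mul_ne_zero (mul_ne_zero (mul_ne_zero h1 h2) h4) (Real.exp_ne_zero _))
  calc (0:ENNReal) < volume (Ioi R) := by simp
    _ ≤ volume _ := measure_mono hsub
    _ ≤ _ := Measure.le_restrict_apply _ _

open Polynomial in
lemma mb_form (θ α : ℝ) (hθ : 0 < θ) (hα : -1 < α)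
    (n : ℕ) (hn : 0 < n)
    (V : ℝ → ℝ) (hVcont : ContinuousOn V (Set.Ici 0))
    (hVgrowth : Tendsto (fun x => V x / Real.log x) atTop atTop) :
    ∃ B : ℝ[X] →ₗ[ℝ] ℝ[X] →ₗ[ℝ] ℝ, ∀ p q, B p q = kappaInt θ α n V p q := by
  have hi := mb_int θ α hθ hα n hn V hVcont hVgrowth
  refine ⟨LinearMap.mk₂ ℝ (kappaInt θ α n V) ?_ ?_ ?_ ?_, fun p q => rfl⟩
  · intro p p' q
    unfold kappaInt
    rw [← integral_add (hi p q) (hi p' q)]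
    congr 1; ext x; simp only [eval_add]; ring
  · intro c p q
    unfold kappaInt
    rw [smul_eq_mul, ← integral_const_mul]
    congr 1; ext x; simp only [eval_smul, smul_eq_mul]; ring
  · intro p q q'
    unfold kappaInt
    rw [← integral_add (hi p q) (hi p q')]
    congr 1; ext x; simp only [eval_add]; ring
  · intro c p q
    unfold kappaInt
    rw [smul_eq_mul, ← integral_const_mul]
    congr 1; ext x; simp only [eval_smul, smul_eq_mul]; ring

open Polynomial in
lemma mb_orth (L : ℝ[X] →ₗ[ℝ] ℝ) (j : ℕ) (h : ∀ k < j, L (X ^ k) = 0) (q : ℝ[X])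
    (hq : q.degree < j) : L q = 0 := by
  by_cases hq0 : q = 0
  · simp [hq0]
  have hq' := (natDegree_lt_iff_degree_lt hq0).mpr hq
  rw [q.as_sum_range_C_mul_X_pow, map_sum]
  refine Finset.sum_eq_zero fun i hi => ?_
  rw [← smul_eq_C_mul, map_smul, h i (by have := Finset.mem_range.mp hi; omega), smul_zero]

/-- Existence, uniqueness, and biorthogonality of the Muttalib-Borodin biorthogonal
polynomials for the weight `x^α e^(-n V(x))` on `(0, ∞)`. -/
theorem muttalib_borodin_biorthogonal_polynomials
    (θ α : ℝ) (hθ : 0 < θ) (hα : -1 < α)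
    (n : ℕ) (hn : 0 < n)
    (V : ℝ → ℝ) (hVcont : ContinuousOn V (Set.Ici 0))
    (hVgrowth : Tendsto (fun x => V x / Real.log x) atTop atTop) :
    ∀ j : ℕ,
      (∃! p : Polynomial ℝ, PCond θ α n V j p) ∧
      (∃! q : Polynomial ℝ, QCond θ α n V j q) ∧
      (∀ p q : Polynomial ℝ, PCond θ α n V j p → QCond θ α n V j q →
        0 < kappaInt θ α n V p q) ∧
      (∀ k : ℕ, ∀ p q : Polynomial ℝ, PCond θ α n V j p → QCond θ α n V k q →
        j ≠ k → kappaInt θ α n V p q = 0) := by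
  obtain ⟨B, hB⟩ := mb_form θ α hθ hα n hn V hVcont hVgrowth
  have hpos := mb_pos θ α hθ hα n hn V hVcont hVgrowth
  have hP : ∀ j p, PCond θ α n V j p ↔
      (p.Monic ∧ p.natDegree = j ∧ ∀ k < j, B p (Polynomial.X ^ k) = 0) := by
    intro j p
    have : ∀ k : ℕ, B p (Polynomial.X ^ k) = ∫ x in Set.Ioi (0:ℝ),
        p.eval x * x ^ (θ * (k : ℝ) + α) * Real.exp (-(n : ℝ) * V x) := by
      intro k
      rw [hB, kappaInt]
      refine setIntegral_congr_fun measurableSet_Ioi fun x hx => ?_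
      have hx : 0 < x := hx
      simp only [Polynomial.eval_pow, Polynomial.eval_X]
      rw [Real.rpow_add hx, Real.rpow_mul hx.le, Real.rpow_natCast]
      ring
    simp only [PCond, this]
  have hQ : ∀ j q, QCond θ α n V j q ↔
      (q.Monic ∧ q.natDegree = j ∧ ∀ k < j, B.flip q (Polynomial.X ^ k) = 0) := by
    intro j q
    simp only [QCond, LinearMap.flip_apply, hB, kappaInt, Polynomial.eval_pow, Polynomial.eval_X]
  have hPu : ∀ j, ∃! p : Polynomial ℝ, PCond θ α n V j p := by
    intro j
    simp only [hP]
    refine mb_abstract B (fun p hp => ?_) j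
    obtain ⟨q, _, hqd, h⟩ := hpos p hp
    refine ⟨q, hqd, fun h0 => ?_⟩
    rw [← hB, h0] at h
    simp at h
  have hsub : ∀ (j : ℕ) (q q' : Polynomial ℝ), q.Monic → q.natDegree = j → q'.Monic →
      q'.natDegree = j → (q - q').degree < (j : ℕ) := by
    intro j q q' hq hqd hq' hqd'
    have h1 : q.degree = j := by rw [Polynomial.degree_eq_natDegree hq.ne_zero, hqd]
    have h2 : q'.degree = j := by rw [Polynomial.degree_eq_natDegree hq'.ne_zero, hqd']
    rw [← h1]
    exact Polynomial.degree_sub_lt_left (h1.trans h2.symm) hq.ne_zero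
      (by rw [hq.leadingCoeff, hq'.leadingCoeff])
  have hK : ∀ (j : ℕ) (p q : Polynomial ℝ), PCond θ α n V j p → q.Monic → q.natDegree = j →
      0 < B p q := by
    intro j p q hp hq hqd
    obtain ⟨hm, hd, ho⟩ := (hP j p).mp hp
    obtain ⟨r, hr, hrd, h⟩ := hpos p hm.ne_zero
    rw [hm.leadingCoeff, one_mul, ← hB] at h
    have hrj : r.natDegree = j := by
      by_contra hne
      have hlt : r.natDegree < j := by omega
      have := mb_orth (B p) j ho r ((Polynomial.natDegree_lt_iff_degree_lt hr.ne_zero).mp hlt)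
      linarith
    have := mb_orth (B p) j ho _ (hsub j q r hq hqd hr hrj)
    rw [map_sub] at this
    linarith
  have hQu : ∀ j, ∃! q : Polynomial ℝ, QCond θ α n V j q := by
    intro j
    simp only [hQ]
    refine mb_abstract B.flip (fun q hq => ?_) j
    obtain ⟨p, hp, _⟩ := hPu q.natDegree
    refine ⟨p, hp.2.1.le, ?_⟩
    have hlc : q.leadingCoeff ≠ 0 := Polynomial.leadingCoeff_ne_zero.mpr hq
    have h := hK _ p (q.leadingCoeff⁻¹ • q) hp
      (by
        rw [Polynomial.smul_eq_C_mul, mul_comm]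
        exact Polynomial.monic_mul_leadingCoeff_inv hq)
      (by rw [Polynomial.natDegree_smul _ (inv_ne_zero hlc)])
    rw [map_smul] at h
    intro h0
    rw [LinearMap.flip_apply] at h0
    rw [h0] at h
    simp at h
  intro j
  refine ⟨hPu j, hQu j, ?_, ?_⟩
  · intro p q hp hq
    rw [← hB]
    exact hK j p q hp hq.1 hq.2.1
  · intro k p q hp hq hjk
    rw [← hB]
    obtain ⟨hm, hd, ho⟩ := (hP j p).mp hp
    obtain ⟨hm', hd', ho'⟩ := (hQ k q).mp hq
    rcases lt_or_gt_of_ne hjk with h | h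
    · exact mb_orth (B.flip q) k ho' p
        ((Polynomial.natDegree_lt_iff_degree_lt hm.ne_zero).mp (by omega))
    · exact mb_orth (B p) j ho q
        ((Polynomial.natDegree_lt_iff_degree_lt hm'.ne_zero).mp (by omega))
end

section
/- Let (f₋, f₊) ∈ V_α(R) and let (h₋, h₊) satisfy the H-type jump conditions with the same parameters θ, α, γ, R. Then the pairing Φ(R') = (1/(2πi))·∮_{|z|=R'} h(z)·f(z)·dz/z is independent of R': Φ(R₁) = Φ(R₂) for all R₁, R₂ ∈ (0, R). -/
open Filter Set Asymptotics Topology Real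
open scoped ENNReal

noncomputable section

/-- The left sector `S₋ = {0 < |z| < R, |arg(-z)| < (π-γ)/(1+θ⁻¹)}`. -/
def SmV (θ γ : ℝ) (R : ℝ≥0∞) : Set ℂ :=
  {z | 0 < ‖z‖ ∧ ENNReal.ofReal ‖z‖ < R ∧
    |Complex.arg (-z)| < (π - γ) / (1 + θ⁻¹)}

/-- The right sector `S₊ = {0 < |z| < R, |arg z| < (θ⁻¹π+γ)/(1+θ⁻¹)}`. -/
def SpV (θ γ : ℝ) (R : ℝ≥0∞) : Set ℂ :=
  {z | 0 < ‖z‖ ∧ ENNReal.ofReal ‖z‖ < R ∧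
    |Complex.arg z| < (θ⁻¹ * π + γ) / (1 + θ⁻¹)}

/-- The upper bounding ray `arg z = (θ⁻¹π+γ)/(1+θ⁻¹)`. -/
def rayPlusV (θ γ : ℝ) (R : ℝ≥0∞) : Set ℂ :=
  {z | 0 < ‖z‖ ∧ ENNReal.ofReal ‖z‖ < R ∧
    Complex.arg z = (θ⁻¹ * π + γ) / (1 + θ⁻¹)}

/-- The lower bounding ray `arg z = -(θ⁻¹π+γ)/(1+θ⁻¹)`. -/
def rayMinusV (θ γ : ℝ) (R : ℝ≥0∞) : Set ℂ :=
  {z | 0 < ‖z‖ ∧ ENNReal.ofReal ‖z‖ < R ∧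
    Complex.arg z = -((θ⁻¹ * π + γ) / (1 + θ⁻¹))}

/-- Membership of a pair `(f₋, f₊)` in the function space `V_α(R)`:
analyticity on the two sectors, continuity up to the bounding rays, the jump
conditions across the two rays, and the prescribed growth behaviour at `0`. -/
structure MemV (θ α γ : ℝ) (R : ℝ≥0∞) (fm fp : ℂ → ℂ) : Prop where
  anal_m : AnalyticOnNhd ℂ fm (SmV θ γ R)
  anal_p : AnalyticOnNhd ℂ fp (SpV θ γ R)
  cont_m : ContinuousOn fm (SmV θ γ R ∪ rayPlusV θ γ R ∪ rayMinusV θ γ R)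
  cont_p : ContinuousOn fp (SpV θ γ R ∪ rayPlusV θ γ R ∪ rayMinusV θ γ R)
  jump_plus : ∀ z ∈ rayPlusV θ γ R,
    fm z - fp z = -Complex.exp (-(2 * α + 3) * π * Complex.I / (θ + 1)) *
      fp (z * Complex.exp (-2 * π * Complex.I / (θ + 1)))
  jump_minus : ∀ z ∈ rayMinusV θ γ R,
    fp z - fm z = Complex.exp ((2 * α + 3) * π * Complex.I / (θ + 1)) *
      fp (z * Complex.exp (2 * π * Complex.I / (θ + 1)))
  grow_hi : θ - 1 < α →
    (fm =O[nhdsWithin 0 (SmV θ γ R)] fun z : ℂ => z ^ (((-1/2 + (α + 1)/θ : ℝ)) : ℂ)) ∧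
    (fp =O[nhdsWithin 0 (SpV θ γ R)] fun z : ℂ => z ^ (((θ - α - 1/2 : ℝ)) : ℂ))
  grow_eq : α = θ - 1 →
    (fm =O[nhdsWithin 0 (SmV θ γ R)] fun z : ℂ => z ^ ((1/2 : ℂ))) ∧
    (fp =O[nhdsWithin 0 (SpV θ γ R)] fun z : ℂ => z ^ ((1/2 : ℂ)) * Complex.log z)
  grow_lo : α < θ - 1 →
    (fm =O[nhdsWithin 0 (SmV θ γ R)] fun z : ℂ => z ^ (((-1/2 + (α + 1)/θ : ℝ)) : ℂ)) ∧
    (fp =O[nhdsWithin 0 (SpV θ γ R)] fun z : ℂ => z ^ (((-1/2 + (α + 1)/θ : ℝ)) : ℂ))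

/-- The bound `limsup_k |a_k|^(1/k) ≤ B` (in `ℝ≥0∞`, so that `B = 0` forces the
limsup to vanish, which is the `R = ∞` convention). -/
def LimsupRootBound (a : ℕ → ℂ) (B : ℝ≥0∞) : Prop :=
  Filter.limsup (fun k : ℕ => ENNReal.ofReal (‖a k‖ ^ ((1 : ℝ) / k))) atTop ≤ B

/- The factor `c_k(z)` in the series representation on the right sector:
`1/(2 sin(π(k+α+1)/θ))` in the generic case, and
`((θ+1)/(2π)) (-1)^((k+α+1)/θ) log z` in the resonant case `(k+α+1)/θ ∈ ℤ`. -/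
open Classical in
def ckFactor (θ α : ℝ) (k : ℕ) (z : ℂ) : ℂ :=
  if ∃ m : ℤ, ((k : ℝ) + α + 1) / θ = (m : ℝ) then
    (((θ + 1) / (2 * π) : ℝ) : ℂ) *
      (-1 : ℂ) ^ (((((k : ℝ) + α + 1) / θ : ℝ)) : ℂ) * Complex.log z
  else
    (1 : ℂ) / (((2 * Real.sin (π * (((k : ℝ) + α + 1) / θ)) : ℝ)) : ℂ)

/-- The `k`-th term of the series on the left sector. -/
def fmTerm (θ : ℝ) (a : ℕ → ℂ) (k : ℕ) (z : ℂ) : ℂ :=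
  a k * (-z) ^ (((((θ + 1) * k / θ : ℝ))) : ℂ)

/-- The sum of the series on the left sector:
`f₋(z) = (-z)^(-1/2+(α+1)/θ) Σ_k a_k (-z)^((θ+1)k/θ)`. -/
def fmSeries (θ α : ℝ) (a : ℕ → ℂ) (z : ℂ) : ℂ :=
  (-z) ^ (((-1/2 + (α + 1)/θ : ℝ)) : ℂ) * ∑' k : ℕ, fmTerm θ a k z

/-- The `k`-th term of the first series on the right sector. -/
def fpTermA (θ α : ℝ) (a : ℕ → ℂ) (k : ℕ) (z : ℂ) : ℂ :=
  (-1 : ℂ) ^ k * a k * z ^ (((((θ + 1) * k / θ : ℝ))) : ℂ) * ckFactor θ α k z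

/-- The `k`-th term of the second series on the right sector. -/
def fpTermB (θ : ℝ) (b : ℕ → ℂ) (k : ℕ) (z : ℂ) : ℂ :=
  b k * z ^ (((((θ + 1) * k : ℝ))) : ℂ)

/-- The sum of the two series on the right sector:
`f₊(z) = z^(-1/2+(α+1)/θ) Σ_k (-1)^k a_k z^((θ+1)k/θ) c_k(z)
        + z^(θ-α-1/2) Σ_k b_k z^((θ+1)k)`. -/
def fpSeries (θ α : ℝ) (a b : ℕ → ℂ) (z : ℂ) : ℂ :=
  z ^ (((-1/2 + (α + 1)/θ : ℝ)) : ℂ) * (∑' k : ℕ, fpTermA θ α a k z) +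
    z ^ (((θ - α - 1/2 : ℝ)) : ℂ) * (∑' k : ℕ, fpTermB θ b k z)

/-- The `H`-side right sector `{0 < |z| < R, |arg z| < (θ⁻¹π-γ)/(1+θ⁻¹)}`. -/
def HpS (θ γ : ℝ) (R : ℝ≥0∞) : Set ℂ :=
  {z | 0 < ‖z‖ ∧ ENNReal.ofReal ‖z‖ < R ∧
    |Complex.arg z| < (θ⁻¹ * π - γ) / (1 + θ⁻¹)}

/-- The `H`-side left sector `{0 < |z| < R, |arg(-z)| < (π+γ)/(1+θ⁻¹)}`. -/
def HmS (θ γ : ℝ) (R : ℝ≥0∞) : Set ℂ :=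
  {z | 0 < ‖z‖ ∧ ENNReal.ofReal ‖z‖ < R ∧
    |Complex.arg (-z)| < (π + γ) / (1 + θ⁻¹)}

/-- The upper `H`-ray `arg z = (θ⁻¹π-γ)/(1+θ⁻¹)`. -/
def rayPlusH (θ γ : ℝ) (R : ℝ≥0∞) : Set ℂ :=
  {z | 0 < ‖z‖ ∧ ENNReal.ofReal ‖z‖ < R ∧
    Complex.arg z = (θ⁻¹ * π - γ) / (1 + θ⁻¹)}

/-- The lower `H`-ray `arg z = -(θ⁻¹π-γ)/(1+θ⁻¹)`. -/
def rayMinusH (θ γ : ℝ) (R : ℝ≥0∞) : Set ℂ :=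
  {z | 0 < ‖z‖ ∧ ENNReal.ofReal ‖z‖ < R ∧
    Complex.arg z = -((θ⁻¹ * π - γ) / (1 + θ⁻¹))}

/-- A pair `(h₋, h₊)` satisfying the `H`-type jump conditions: analyticity on the two
`H`-sectors, continuity up to the bounding `H`-rays, and the jump relations across the
two rays. -/
structure MemH (θ α γ : ℝ) (R : ℝ≥0∞) (hm hp : ℂ → ℂ) : Prop where
  anal_p : AnalyticOnNhd ℂ hp (HpS θ γ R)
  anal_m : AnalyticOnNhd ℂ hm (HmS θ γ R)
  cont_p : ContinuousOn hp (HpS θ γ R ∪ rayPlusH θ γ R ∪ rayMinusH θ γ R)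
  cont_m : ContinuousOn hm (HmS θ γ R ∪ rayPlusH θ γ R ∪ rayMinusH θ γ R)
  jump_plus : ∀ z ∈ rayPlusH θ γ R,
    hm z - hp z = -Complex.exp ((2 * α + 3) * π * Complex.I / (θ + 1)) *
      hm (z * Complex.exp (-2 * π * Complex.I / (θ + 1)))
  jump_minus : ∀ z ∈ rayMinusH θ γ R,
    hp z - hm z = Complex.exp (-(2 * α + 3) * π * Complex.I / (θ + 1)) *
      hm (z * Complex.exp (2 * π * Complex.I / (θ + 1)))

/-- The combined value of the pair `(f₋, f₊)`: `f₊ z` if `z` lies in (the closure of)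
the right `V`-sector `|arg z| < (θ⁻¹π+γ)/(1+θ⁻¹)`, and `f₋ z` otherwise. -/
noncomputable def Vval (θ γ : ℝ) (fm fp : ℂ → ℂ) (z : ℂ) : ℂ :=
  if |Complex.arg z| < (θ⁻¹ * π + γ) / (1 + θ⁻¹) then fp z else fm z

/-- The combined value of the pair `(h₋, h₊)`: `h₊ z` if `z` lies in the right
`H`-sector `|arg z| < (θ⁻¹π-γ)/(1+θ⁻¹)`, and `h₋ z` otherwise. -/
noncomputable def Hval (θ γ : ℝ) (hm hp : ℂ → ℂ) (z : ℂ) : ℂ :=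
  if |Complex.arg z| < (θ⁻¹ * π - γ) / (1 + θ⁻¹) then hp z else hm z

/-- The pairing `Φ(R') = (1/(2πi)) ∮_{|z|=R'} h(z) f(z) dz/z`, written via the
parametrization `z = R' e^(it)` as `(1/(2π)) ∫_{-π}^{π} h(R'e^(it)) f(R'e^(it)) dt`. -/
noncomputable def pairingPhi (θ γ : ℝ) (fm fp hm hp : ℂ → ℂ) (R' : ℝ) : ℂ :=
  ((1 / (2 * π) : ℝ) : ℂ) *
    ∫ t in (-π)..π,
      Hval θ γ hm hp ((R' : ℂ) * Complex.exp (t * Complex.I)) *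
        Vval θ γ fm fp ((R' : ℂ) * Complex.exp (t * Complex.I))

end

/-- The argument of an exponential, for imaginary part in the principal range. -/
theorem aux_arg_exp (u : ℂ) (h1 : -π < u.im) (h2 : u.im ≤ π) :
    Complex.arg (Complex.exp u) = u.im := by
  rw [← Complex.log_im, Complex.log_exp h1 h2]

theorem aux_arg_neg_exp_pos (u : ℂ) (h1 : 0 < u.im) (h2 : u.im ≤ π) :
    Complex.arg (-Complex.exp u) = u.im - π := by
  have e : -Complex.exp u = Complex.exp (u - π * Complex.I) := by
    rw [Complex.exp_sub_pi_mul_I]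
  rw [e, aux_arg_exp]
  · simp
  · simp; linarith
  · simp; linarith [Real.pi_pos]

theorem aux_arg_neg_exp_neg (u : ℂ) (h1 : u.im < 0) (h2 : -π ≤ u.im) :
    Complex.arg (-Complex.exp u) = u.im + π := by
  have e : -Complex.exp u = Complex.exp (u + π * Complex.I) := by
    rw [Complex.exp_add_pi_mul_I]
  rw [e, aux_arg_exp]
  · simp
  · simp; linarith [Real.pi_pos]
  · simp; linarith

theorem aux_abs_arg_neg_exp (u : ℂ) (h0 : 0 < |u.im|) (h : |u.im| ≤ π) :
    |Complex.arg (-Complex.exp u)| = π - |u.im| := by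
  rcases lt_or_gt_of_ne (abs_pos.1 h0) with h1 | h1
  · rw [abs_of_neg h1] at h ⊢
    rw [aux_arg_neg_exp_neg u h1 (by linarith), abs_of_nonneg (by linarith)]; ring
  · rw [abs_of_pos h1] at h ⊢
    rw [aux_arg_neg_exp_pos u h1 h, abs_of_nonpos (by linarith)]; ring

/-- Closed right sector in logarithmic coordinates: continuity. -/
theorem aux_contP (R : ℝ≥0∞) (a : ℝ) (haπ : a < π) (φ : ℂ → ℂ)
    (hc : ContinuousOn φ
      ({z : ℂ | 0 < ‖z‖ ∧ ENNReal.ofReal ‖z‖ < R ∧ |Complex.arg z| < a} ∪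
        {z : ℂ | 0 < ‖z‖ ∧ ENNReal.ofReal ‖z‖ < R ∧ Complex.arg z = a} ∪
        {z : ℂ | 0 < ‖z‖ ∧ ENNReal.ofReal ‖z‖ < R ∧ Complex.arg z = -a})) :
    ContinuousOn (fun u => φ (Complex.exp u))
      {u : ℂ | ENNReal.ofReal (Real.exp u.re) < R ∧ |u.im| ≤ a} := by
  refine hc.comp Complex.continuous_exp.continuousOn ?_
  rintro u ⟨hu, hi⟩
  have hi' := abs_le.1 hi
  have hn : 0 < ‖Complex.exp u‖ ∧ ENNReal.ofReal ‖Complex.exp u‖ < R := by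
    rw [Complex.norm_exp]; exact ⟨Real.exp_pos _, hu⟩
  have ha := aux_arg_exp u (by linarith) (by linarith)
  rcases hi.lt_or_eq with h | h
  · exact Or.inl (Or.inl ⟨hn.1, hn.2, by rw [ha]; exact h⟩)
  · rcases abs_choice u.im with h' | h'
    · exact Or.inl (Or.inr ⟨hn.1, hn.2, by rw [ha]; linarith⟩)
    · exact Or.inr ⟨hn.1, hn.2, by rw [ha]; linarith⟩

theorem aux_diffP (R : ℝ≥0∞) (a : ℝ) (haπ : a < π) (φ : ℂ → ℂ)
    (hd : AnalyticOnNhd ℂ φ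
      {z : ℂ | 0 < ‖z‖ ∧ ENNReal.ofReal ‖z‖ < R ∧ |Complex.arg z| < a})
    (u : ℂ) (hu : ENNReal.ofReal (Real.exp u.re) < R) (hi : |u.im| < a) :
    DifferentiableAt ℂ (fun u => φ (Complex.exp u)) u := by
  have hi' := abs_lt.1 hi
  have hn : 0 < ‖Complex.exp u‖ ∧ ENNReal.ofReal ‖Complex.exp u‖ < R := by
    rw [Complex.norm_exp]; exact ⟨Real.exp_pos _, hu⟩
  have ha := aux_arg_exp u (by linarith) (by linarith)
  exact (hd _ ⟨hn.1, hn.2, by rw [ha]; exact hi⟩).differentiableAt.comp u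
    Complex.differentiable_exp.differentiableAt

theorem aux_contM (R : ℝ≥0∞) (a c : ℝ) (ha0 : 0 < a) (haπ : a < π) (hca : c = π - a)
    (φ : ℂ → ℂ)
    (hc : ContinuousOn φ
      ({z : ℂ | 0 < ‖z‖ ∧ ENNReal.ofReal ‖z‖ < R ∧ |Complex.arg (-z)| < c} ∪
        {z : ℂ | 0 < ‖z‖ ∧ ENNReal.ofReal ‖z‖ < R ∧ Complex.arg z = a} ∪
        {z : ℂ | 0 < ‖z‖ ∧ ENNReal.ofReal ‖z‖ < R ∧ Complex.arg z = -a})) :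
    ContinuousOn (fun u => φ (Complex.exp u))
      {u : ℂ | ENNReal.ofReal (Real.exp u.re) < R ∧ a ≤ |u.im| ∧ |u.im| ≤ π} := by
  refine hc.comp Complex.continuous_exp.continuousOn ?_
  rintro u ⟨hu, hi, hi2⟩
  have hn : 0 < ‖Complex.exp u‖ ∧ ENNReal.ofReal ‖Complex.exp u‖ < R := by
    rw [Complex.norm_exp]; exact ⟨Real.exp_pos _, hu⟩
  rcases hi.lt_or_eq with h | h
  · refine Or.inl (Or.inl ⟨hn.1, hn.2, ?_⟩)
    rw [aux_abs_arg_neg_exp u (by linarith) hi2]; linarith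
  · have hi' : -a ≤ u.im ∧ u.im ≤ a := abs_le.1 h.symm.le
    have ha := aux_arg_exp u (by linarith) (by linarith)
    rcases abs_choice u.im with h' | h'
    · exact Or.inl (Or.inr ⟨hn.1, hn.2, by rw [ha]; linarith⟩)
    · exact Or.inr ⟨hn.1, hn.2, by rw [ha]; linarith⟩

theorem aux_diffM (R : ℝ≥0∞) (a c : ℝ) (ha0 : 0 < a) (hca : c = π - a) (φ : ℂ → ℂ)
    (hd : AnalyticOnNhd ℂ φ
      {z : ℂ | 0 < ‖z‖ ∧ ENNReal.ofReal ‖z‖ < R ∧ |Complex.arg (-z)| < c})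
    (u : ℂ) (hu : ENNReal.ofReal (Real.exp u.re) < R) (hi : a < |u.im|) (hi2 : |u.im| ≤ π) :
    DifferentiableAt ℂ (fun u => φ (Complex.exp u)) u := by
  have hn : 0 < ‖Complex.exp u‖ ∧ ENNReal.ofReal ‖Complex.exp u‖ < R := by
    rw [Complex.norm_exp]; exact ⟨Real.exp_pos _, hu⟩
  refine DifferentiableAt.comp u (hd _ ⟨hn.1, hn.2, ?_⟩).differentiableAt
    Complex.differentiable_exp.differentiableAt
  rw [aux_abs_arg_neg_exp u (by linarith) hi2]; linarith

/-- Horizontal and vertical sections of a function continuous on a rectangle are integrable. -/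
theorem aux_vert (G : ℂ → ℂ) (s₁ s₂ c d s : ℝ) (hs : s ∈ (uIcc (s₁) (s₂)))
    (hc : ContinuousOn G ((uIcc (s₁) (s₂)) ×ℂ (uIcc (c) (d)))) :
    IntervalIntegrable (fun y : ℝ => G (s + y * Complex.I)) MeasureTheory.volume c d := by
  refine ContinuousOn.intervalIntegrable (hc.comp (by fun_prop) ?_)
  intro y hy
  simpa [Complex.mem_reProdIm] using ⟨hs, hy⟩

theorem aux_horiz (G : ℂ → ℂ) (s₁ s₂ c d y : ℝ) (hy : y ∈ (uIcc (c) (d)))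
    (hc : ContinuousOn G ((uIcc (s₁) (s₂)) ×ℂ (uIcc (c) (d)))) :
    IntervalIntegrable (fun x : ℝ => G (x + y * Complex.I)) MeasureTheory.volume s₁ s₂ := by
  refine ContinuousOn.intervalIntegrable (hc.comp (by fun_prop) ?_)
  intro x hx
  simpa [Complex.mem_reProdIm] using ⟨hx, hy⟩

/-- Cauchy's theorem on a rectangle, in difference form. -/
theorem aux_cauchy (G : ℂ → ℂ) (s₁ s₂ c d : ℝ) (hcd : c ≤ d)
    (hc : ContinuousOn G ((uIcc (s₁) (s₂)) ×ℂ (uIcc (c) (d))))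
    (hd : ∀ u : ℂ, u.re ∈ (uIcc (s₁) (s₂)) → c < u.im → u.im < d → DifferentiableAt ℂ G u) :
    Complex.I * ((∫ y : ℝ in c..d, G (s₂ + y * Complex.I)) -
        ∫ y : ℝ in c..d, G (s₁ + y * Complex.I)) =
      (∫ x : ℝ in s₁..s₂, G (x + d * Complex.I)) -
        ∫ x : ℝ in s₁..s₂, G (x + c * Complex.I) := by
  have h := Complex.integral_boundary_rect_eq_zero_of_continuousOn_of_differentiableOn G
    ⟨s₁, c⟩ ⟨s₂, d⟩ hc (by
      intro u hu
      rw [Complex.mem_reProdIm] at hu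
      obtain ⟨h1, h2⟩ := hu
      simp only [min_eq_left hcd, max_eq_right hcd] at h2
      exact (hd u ⟨h1.1.le, h1.2.le⟩ h2.1 h2.2).differentiableWithinAt)
  simp only [smul_eq_mul] at h
  linear_combination h

/-- The pairing `Φ(R') = (1/(2πi)) ∮_{|z|=R'} h(z) f(z) dz/z` between a pair
`(f₋,f₊) ∈ V_α(R)` and a pair `(h₋,h₊)` satisfying the `H`-type jump conditions is
independent of the radius `R' ∈ (0, R)`. -/
theorem pairing_radius_independent
    (θ α γ : ℝ) (hθ : 0 < θ) (hα : -1 < α)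
    (hγ : 0 < γ) (hγ' : γ < min π (π / θ))
    (R : ℝ≥0∞) (hR : 0 < R)
    (fm fp hm hp : ℂ → ℂ)
    (hV : MemV θ α γ R fm fp) (hH : MemH θ α γ R hm hp) :
    ∀ R₁ R₂ : ℝ, 0 < R₁ → ENNReal.ofReal R₁ < R → 0 < R₂ → ENNReal.ofReal R₂ < R →
      pairingPhi θ γ fm fp hm hp R₁ = pairingPhi θ γ fm fp hm hp R₂ := by
  intro R₁ R₂ hR₁ hR₁' hR₂ hR₂'
  obtain ⟨hγ1, hγ2⟩ := lt_min_iff.1 hγ'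
  have hπ := Real.pi_pos
  have hθi : 0 < θ⁻¹ := inv_pos.2 hθ
  have hγ3 : γ < θ⁻¹ * π := by rwa [div_eq_inv_mul] at hγ2
  have hV1 := hV.anal_m
  have hV2 := hV.anal_p
  have hV3 := hV.cont_m
  have hV4 := hV.cont_p
  have hV5 := hV.jump_plus
  have hV6 := hV.jump_minus
  have hH1 := hH.anal_m
  have hH2 := hH.anal_p
  have hH3 := hH.cont_m
  have hH4 := hH.cont_p
  have hH5 := hH.jump_plus
  have hH6 := hH.jump_minus
  unfold SmV at hV1 hV3
  unfold SpV at hV2 hV4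
  unfold rayPlusV at hV3 hV4 hV5
  unfold rayMinusV at hV3 hV4 hV6
  unfold HmS at hH1 hH3
  unfold HpS at hH2 hH4
  unfold rayPlusH at hH3 hH4 hH5
  unfold rayMinusH at hH3 hH4 hH6
  unfold pairingPhi Hval Vval
  have hden : 0 < 1 + θ⁻¹ := by linarith
  have hac : (π - γ) / (1 + θ⁻¹) = π - (θ⁻¹ * π + γ) / (1 + θ⁻¹) := by
    field_simp; ring
  have hbc : (π + γ) / (1 + θ⁻¹) = π - (θ⁻¹ * π - γ) / (1 + θ⁻¹) := by
    field_simp; ring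
  have hab : (θ⁻¹ * π + γ) / (1 + θ⁻¹) + (θ⁻¹ * π - γ) / (1 + θ⁻¹) = 2 * π / (θ + 1) := by
    field_simp; ring
  have hb0 : 0 < (θ⁻¹ * π - γ) / (1 + θ⁻¹) := div_pos (by linarith) hden
  have hba : (θ⁻¹ * π - γ) / (1 + θ⁻¹) < (θ⁻¹ * π + γ) / (1 + θ⁻¹) :=
    div_lt_div_of_pos_right (by linarith) hden
  have haπ : (θ⁻¹ * π + γ) / (1 + θ⁻¹) < π := by
    rw [div_lt_iff₀ hden]; nlinarith
  generalize (θ⁻¹ * π + γ) / (1 + θ⁻¹) = a at *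
  generalize (θ⁻¹ * π - γ) / (1 + θ⁻¹) = b at *
  have ha0 : 0 < a := hb0.trans hba
  have hbπ : b < π := hba.trans haπ
  have cfp := aux_contP R a haπ fp hV4
  have dfp := aux_diffP R a haπ fp hV2
  have chp := aux_contP R b hbπ hp hH4
  have dhp := aux_diffP R b hbπ hp hH2
  have cfm := aux_contM R a _ ha0 haπ hac fm hV3
  have dfm := aux_diffM R a _ ha0 hac fm hV1
  have chm := aux_contM R b _ hb0 hbπ hbc hm hH3
  have dhm := aux_diffM R b _ hb0 hbc hm hH1
  set s₁ := Real.log R₁ with hs₁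
  set s₂ := Real.log R₂ with hs₂
  have e₁ : ∀ t : ℝ, (R₁ : ℂ) * Complex.exp (t * Complex.I)
      = Complex.exp (s₁ + t * Complex.I) := by
    intro t
    rw [Complex.exp_add, ← Complex.ofReal_exp, hs₁, Real.exp_log hR₁]
  have e₂ : ∀ t : ℝ, (R₂ : ℂ) * Complex.exp (t * Complex.I)
      = Complex.exp (s₂ + t * Complex.I) := by
    intro t
    rw [Complex.exp_add, ← Complex.ofReal_exp, hs₂, Real.exp_log hR₂]
  have hs : ∀ x ∈ (uIcc (s₁) (s₂)), ENNReal.ofReal (Real.exp x) < R := by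
    intro x hx
    have : x ≤ max s₁ s₂ := hx.2
    rcases le_max_iff.1 this with h | h
    · refine lt_of_le_of_lt (ENNReal.ofReal_le_ofReal ?_) hR₁'
      rw [← Real.exp_log hR₁]; exact Real.exp_le_exp.2 h
    · refine lt_of_le_of_lt (ENNReal.ofReal_le_ofReal ?_) hR₂'
      rw [← Real.exp_log hR₂]; exact Real.exp_le_exp.2 h
  congr 1
  simp only [e₁, e₂]
  -- the three products
  set Gmm : ℂ → ℂ := fun u => hm (Complex.exp u) * fm (Complex.exp u) with hGmm
  set Gmp : ℂ → ℂ := fun u => hm (Complex.exp u) * fp (Complex.exp u) with hGmp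
  set Gpp : ℂ → ℂ := fun u => hp (Complex.exp u) * fp (Complex.exp u) with hGpp
  have cont1 : ContinuousOn Gmm ((uIcc (s₁) (s₂)) ×ℂ (uIcc (-π) (-a))) := by
    rw [uIcc_of_le (by linarith : -π ≤ -a)]
    refine (chm.mono ?_).mul (cfm.mono ?_) <;>
    · rintro u ⟨h1, h2, h3⟩
      have : |u.im| = -u.im := abs_of_neg (by linarith)
      exact ⟨hs _ h1, by linarith, by linarith⟩
  have cont2 : ContinuousOn Gmp ((uIcc (s₁) (s₂)) ×ℂ (uIcc (-a) (-b))) := by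
    rw [uIcc_of_le (by linarith : -a ≤ -b)]
    refine (chm.mono ?_).mul (cfp.mono ?_)
    · rintro u ⟨h1, h2, h3⟩
      have : |u.im| = -u.im := abs_of_neg (by linarith)
      exact ⟨hs _ h1, by linarith, by linarith⟩
    · rintro u ⟨h1, h2, h3⟩
      have : |u.im| = -u.im := abs_of_neg (by linarith)
      exact ⟨hs _ h1, by linarith⟩
  have cont3 : ContinuousOn Gpp ((uIcc (s₁) (s₂)) ×ℂ (uIcc (-b) (b))) := by
    rw [uIcc_of_le (by linarith : -b ≤ b)]
    refine (chp.mono ?_).mul (cfp.mono ?_) <;>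
    · rintro u ⟨h1, h2, h3⟩
      have : |u.im| ≤ b := abs_le.2 ⟨h2, h3⟩
      exact ⟨hs _ h1, by linarith⟩
  have cont4 : ContinuousOn Gmp ((uIcc (s₁) (s₂)) ×ℂ (uIcc (b) (a))) := by
    rw [uIcc_of_le (by linarith : b ≤ a)]
    refine (chm.mono ?_).mul (cfp.mono ?_)
    · rintro u ⟨h1, h2, h3⟩
      have : |u.im| = u.im := abs_of_pos (by linarith)
      exact ⟨hs _ h1, by linarith, by linarith⟩
    · rintro u ⟨h1, h2, h3⟩
      have : |u.im| = u.im := abs_of_pos (by linarith)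
      exact ⟨hs _ h1, by linarith⟩
  have cont5 : ContinuousOn Gmm ((uIcc (s₁) (s₂)) ×ℂ (uIcc (a) (π))) := by
    rw [uIcc_of_le (by linarith : a ≤ π)]
    refine (chm.mono ?_).mul (cfm.mono ?_) <;>
    · rintro u ⟨h1, h2, h3⟩
      have : |u.im| = u.im := abs_of_pos (by linarith)
      exact ⟨hs _ h1, by linarith, by linarith⟩
  have C1 := aux_cauchy Gmm s₁ s₂ (-π) (-a) (by linarith) cont1 (by
    intro u h1 h2 h3
    have : |u.im| = -u.im := abs_of_neg (by linarith)
    exact (dhm u (hs _ h1) (by linarith) (by linarith)).mul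
      (dfm u (hs _ h1) (by linarith) (by linarith)))
  have C2 := aux_cauchy Gmp s₁ s₂ (-a) (-b) (by linarith) cont2 (by
    intro u h1 h2 h3
    have : |u.im| = -u.im := abs_of_neg (by linarith)
    exact (dhm u (hs _ h1) (by linarith) (by linarith)).mul
      (dfp u (hs _ h1) (by linarith)))
  have C3 := aux_cauchy Gpp s₁ s₂ (-b) b (by linarith) cont3 (by
    intro u h1 h2 h3
    have : |u.im| < b := abs_lt.2 ⟨h2, h3⟩
    exact (dhp u (hs _ h1) (by linarith)).mul (dfp u (hs _ h1) (by linarith)))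
  have C4 := aux_cauchy Gmp s₁ s₂ b a (by linarith) cont4 (by
    intro u h1 h2 h3
    have : |u.im| = u.im := abs_of_pos (by linarith)
    exact (dhm u (hs _ h1) (by linarith) (by linarith)).mul
      (dfp u (hs _ h1) (by linarith)))
  have C5 := aux_cauchy Gmm s₁ s₂ a π (by linarith) cont5 (by
    intro u h1 h2 h3
    have : |u.im| = u.im := abs_of_pos (by linarith)
    exact (dhm u (hs _ h1) (by linarith) (by linarith)).mul
      (dfm u (hs _ h1) (by linarith) (by linarith)))
  -- splitting the circle integral
  have split : ∀ s ∈ (uIcc (s₁) (s₂)),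
      (∫ t : ℝ in (-π)..π,
        (if |Complex.arg (Complex.exp (s + t * Complex.I))| < b then
            hp (Complex.exp (s + t * Complex.I)) else hm (Complex.exp (s + t * Complex.I))) *
          (if |Complex.arg (Complex.exp (s + t * Complex.I))| < a then
            fp (Complex.exp (s + t * Complex.I)) else fm (Complex.exp (s + t * Complex.I)))) =
      (∫ t : ℝ in (-π)..(-a), Gmm (s + t * Complex.I)) +
        (∫ t : ℝ in (-a)..(-b), Gmp (s + t * Complex.I)) +
        (∫ t : ℝ in (-b)..b, Gpp (s + t * Complex.I)) +
        (∫ t : ℝ in b..a, Gmp (s + t * Complex.I)) +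
        (∫ t : ℝ in a..π, Gmm (s + t * Complex.I)) := by
    intro s hsm
    set F : ℝ → ℂ := fun t =>
        (if |Complex.arg (Complex.exp (s + t * Complex.I))| < b then
            hp (Complex.exp (s + t * Complex.I)) else hm (Complex.exp (s + t * Complex.I))) *
          (if |Complex.arg (Complex.exp (s + t * Complex.I))| < a then
            fp (Complex.exp (s + t * Complex.I)) else fm (Complex.exp (s + t * Complex.I)))
      with hF
    have harg : ∀ t : ℝ, -π < t → t < π →
        Complex.arg (Complex.exp (s + t * Complex.I)) = t := by
      intro t h1 h2
      rw [aux_arg_exp] <;> simp <;> linarith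
    have E1 : EqOn (fun t : ℝ => Gmm (s + t * Complex.I)) F (uIoo (-π) (-a)) := by
      intro t ht
      rw [uIoo_of_le (by linarith)] at ht
      obtain ⟨h1, h2⟩ := ht
      have : |t| = -t := abs_of_neg (by linarith)
      simp only [hF, harg t (by linarith) (by linarith)]
      rw [if_neg (by linarith), if_neg (by linarith)]
    have E2 : EqOn (fun t : ℝ => Gmp (s + t * Complex.I)) F (uIoo (-a) (-b)) := by
      intro t ht
      rw [uIoo_of_le (by linarith)] at ht
      obtain ⟨h1, h2⟩ := ht
      have : |t| = -t := abs_of_neg (by linarith)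
      simp only [hF, harg t (by linarith) (by linarith)]
      rw [if_neg (by linarith), if_pos (by linarith)]
    have E3 : EqOn (fun t : ℝ => Gpp (s + t * Complex.I)) F (uIoo (-b) b) := by
      intro t ht
      rw [uIoo_of_le (by linarith)] at ht
      obtain ⟨h1, h2⟩ := ht
      have : |t| < b := abs_lt.2 ⟨h1, h2⟩
      simp only [hF, harg t (by linarith) (by linarith)]
      rw [if_pos (by linarith), if_pos (by linarith)]
    have E4 : EqOn (fun t : ℝ => Gmp (s + t * Complex.I)) F (uIoo b a) := by
      intro t ht
      rw [uIoo_of_le (by linarith)] at ht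
      obtain ⟨h1, h2⟩ := ht
      have : |t| = t := abs_of_pos (by linarith)
      simp only [hF, harg t (by linarith) (by linarith)]
      rw [if_neg (by linarith), if_pos (by linarith)]
    have E5 : EqOn (fun t : ℝ => Gmm (s + t * Complex.I)) F (uIoo a π) := by
      intro t ht
      rw [uIoo_of_le (by linarith)] at ht
      obtain ⟨h1, h2⟩ := ht
      have : |t| = t := abs_of_pos (by linarith)
      simp only [hF, harg t (by linarith) (by linarith)]
      rw [if_neg (by linarith), if_neg (by linarith)]
    have I1 := (aux_vert Gmm s₁ s₂ _ _ s hsm cont1).congr_uIoo E1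
    have I2 := (aux_vert Gmp s₁ s₂ _ _ s hsm cont2).congr_uIoo E2
    have I3 := (aux_vert Gpp s₁ s₂ _ _ s hsm cont3).congr_uIoo E3
    have I4 := (aux_vert Gmp s₁ s₂ _ _ s hsm cont4).congr_uIoo E4
    have I5 := (aux_vert Gmm s₁ s₂ _ _ s hsm cont5).congr_uIoo E5
    rw [intervalIntegral.integral_congr_uIoo E1, intervalIntegral.integral_congr_uIoo E2,
      intervalIntegral.integral_congr_uIoo E3, intervalIntegral.integral_congr_uIoo E4,
      intervalIntegral.integral_congr_uIoo E5,
      intervalIntegral.integral_add_adjacent_intervals I1 I2,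
      intervalIntegral.integral_add_adjacent_intervals (I1.trans I2) I3,
      intervalIntegral.integral_add_adjacent_intervals ((I1.trans I2).trans I3) I4,
      intervalIntegral.integral_add_adjacent_intervals (((I1.trans I2).trans I3).trans I4) I5]
  rw [split s₁ left_mem_uIcc, split s₂ right_mem_uIcc]
  -- ray identities
  have hrot : ∀ x t t' : ℝ, t' = t + 2 * π / (θ + 1) →
      Complex.exp (x + t * Complex.I) * Complex.exp (2 * π * Complex.I / (θ + 1)) =
        Complex.exp (x + t' * Complex.I) := by
    intro x t t' h
    rw [← Complex.exp_add, h]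
    congr 1
    push_cast
    ring
  have hrot' : ∀ x t t' : ℝ, t' = t - 2 * π / (θ + 1) →
      Complex.exp (x + t * Complex.I) * Complex.exp (-2 * π * Complex.I / (θ + 1)) =
        Complex.exp (x + t' * Complex.I) := by
    intro x t t' h
    rw [← Complex.exp_add, h]
    congr 1
    push_cast
    ring
  have hray : ∀ x ∈ (uIcc (s₁) (s₂)), ∀ t : ℝ, -π < t → t ≤ π →
      0 < ‖Complex.exp (x + t * Complex.I)‖ ∧
      ENNReal.ofReal ‖Complex.exp (x + t * Complex.I)‖ < R ∧
      Complex.arg (Complex.exp (x + t * Complex.I)) = t := by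
    intro x hx t h1 h2
    rw [Complex.norm_exp, aux_arg_exp _ (by simpa using h1) (by simpa using h2)]
    refine ⟨Real.exp_pos _, by simpa using hs x hx, by simp⟩
  have per : (∫ x : ℝ in s₁..s₂, Gmm (x + (-π : ℝ) * Complex.I)) =
      ∫ x : ℝ in s₁..s₂, Gmm (x + π * Complex.I) := by
    refine intervalIntegral.integral_congr fun x _ => ?_
    have : Complex.exp (x + (-π : ℝ) * Complex.I) = Complex.exp (x + π * Complex.I) := by
      rw [Complex.exp_eq_exp_iff_exists_int]
      exact ⟨-1, by push_cast; ring⟩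
    simp only [hGmm, this]
  have J1 : (∫ x : ℝ in s₁..s₂, Gmp (x + a * Complex.I)) -
      (∫ x : ℝ in s₁..s₂, Gmm (x + a * Complex.I)) =
      (∫ x : ℝ in s₁..s₂, Gpp (x + (-b : ℝ) * Complex.I)) -
      (∫ x : ℝ in s₁..s₂, Gmp (x + (-b : ℝ) * Complex.I)) := by
    rw [← intervalIntegral.integral_sub (aux_horiz _ _ _ _ _ _ right_mem_uIcc cont4)
      (aux_horiz _ _ _ _ _ _ left_mem_uIcc cont5),
      ← intervalIntegral.integral_sub (aux_horiz _ _ _ _ _ _ left_mem_uIcc cont3)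
      (aux_horiz _ _ _ _ _ _ right_mem_uIcc cont2)]
    refine intervalIntegral.integral_congr fun x hx => ?_
    have k1 := hV5 _ (hray x hx a (by linarith) haπ.le)
    have k2 := hH6 _ (hray x hx (-b) (by linarith) (by linarith))
    rw [hrot' x a (-b) (by linarith)] at k1
    rw [hrot x (-b) a (by linarith)] at k2
    simp only [hGmm, hGmp, hGpp]
    linear_combination (-hm (Complex.exp (x + a * Complex.I))) * k1 -
      fp (Complex.exp (x + (-b : ℝ) * Complex.I)) * k2
  have J2 : (∫ x : ℝ in s₁..s₂, Gpp (x + b * Complex.I)) -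
      (∫ x : ℝ in s₁..s₂, Gmp (x + b * Complex.I)) =
      (∫ x : ℝ in s₁..s₂, Gmp (x + (-a : ℝ) * Complex.I)) -
      (∫ x : ℝ in s₁..s₂, Gmm (x + (-a : ℝ) * Complex.I)) := by
    rw [← intervalIntegral.integral_sub (aux_horiz _ _ _ _ _ _ right_mem_uIcc cont3)
      (aux_horiz _ _ _ _ _ _ left_mem_uIcc cont4),
      ← intervalIntegral.integral_sub (aux_horiz _ _ _ _ _ _ left_mem_uIcc cont2)
      (aux_horiz _ _ _ _ _ _ right_mem_uIcc cont1)]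
    refine intervalIntegral.integral_congr fun x hx => ?_
    have k1 := hH5 _ (hray x hx b (by linarith) hbπ.le)
    have k2 := hV6 _ (hray x hx (-a) (by linarith) (by linarith))
    rw [hrot' x b (-a) (by linarith)] at k1
    rw [hrot x (-a) b (by linarith)] at k2
    simp only [hGmm, hGmp, hGpp]
    linear_combination (-fp (Complex.exp (x + b * Complex.I))) * k1 -
      hm (Complex.exp (x + (-a : ℝ) * Complex.I)) * k2
  refine mul_left_cancel₀ Complex.I_ne_zero ?_
  linear_combination -C1 - C2 - C3 - C4 - C5 + per - J1 - J2
end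

section
/- Let R = ∞, let (f₋, f₊) ∈ V_α(∞) and let (h₋, h₊) satisfy the H-type jump conditions with the same parameters θ, α, γ. (a) Suppose j, k ∈ ℕ with j ≤ k, and there exist A > 0 and R₀ > 0 such that |e^z·f(z) − z^j| ≤ A·|z|^{j−1} for all z in S₋ ∪ S₊ with |z| ≥ R₀ and |e^{−z}·h(z) − z^{−k}| ≤ A·|z|^{−k−1} for all z in the H-sectors with |z| ≥ R₀ (f, h denoting the branch values). Then for every R' > 0 the pairing satisfies Φ(R') = 1 if j = k and Φ(R') = 0 if j < k. (b) If instead sup_{|z|=r} |f(z)·h(z)| → 0 as r → 0⁺, then Φ(R') = 0 for every R' > 0. -/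
open Filter Set Asymptotics Topology Real
open scoped ENNReal

/-- Regularity on a closed horizontal strip. -/
structure StripOK (G : ℂ → ℂ) (t₁ t₂ : ℝ) : Prop where
  cont : ContinuousOn G {w | t₁ ≤ w.im ∧ w.im ≤ t₂}
  diff : ∀ w : ℂ, t₁ < w.im → w.im < t₂ → DifferentiableAt ℂ G w

lemma StripOK.mono {G : ℂ → ℂ} {t₁ t₂ s₁ s₂ : ℝ} (h : StripOK G t₁ t₂) (h1 : t₁ ≤ s₁)
    (h2 : s₂ ≤ t₂) : StripOK G s₁ s₂ :=
  ⟨h.cont.mono fun _ hw => ⟨h1.trans hw.1, hw.2.trans h2⟩,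
    fun w hw hw' => h.diff w (h1.trans_lt hw) (hw'.trans_le h2)⟩

lemma StripOK.mul {G H : ℂ → ℂ} {t₁ t₂ : ℝ} (h : StripOK G t₁ t₂) (h' : StripOK H t₁ t₂) :
    StripOK (fun w => G w * H w) t₁ t₂ :=
  ⟨h.cont.mul h'.cont, fun w hw hw' => (h.diff w hw hw').mul (h'.diff w hw hw')⟩

lemma StripOK.rect {G : ℂ → ℂ} {t₁ t₂ : ℝ} (h : StripOK G t₁ t₂) (ht : t₁ ≤ t₂) (a b : ℝ) :
    Complex.I * ((∫ y in t₁..t₂, G (b + y * Complex.I)) - ∫ y in t₁..t₂, G (a + y * Complex.I))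
      = (∫ x in a..b, G (x + t₂ * Complex.I)) - ∫ x in a..b, G (x + t₁ * Complex.I) := by
  have := Complex.integral_boundary_rect_eq_zero_of_continuousOn_of_differentiableOn G
    (⟨a, t₁⟩ : ℂ) (⟨b, t₂⟩ : ℂ)
    (h.cont.mono (by
      intro w hw
      have := hw.2
      simp only [uIcc_of_le ht] at this
      exact ⟨this.1, this.2⟩))
    (by
      intro w hw
      have := hw.2
      simp only [min_eq_left ht, max_eq_right ht] at this
      exact (h.diff w this.1 this.2).differentiableWithinAt)
  simp only [smul_eq_mul] at this
  linear_combination this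

lemma StripOK.int_h {G : ℂ → ℂ} {t₁ t₂ : ℝ} (h : StripOK G t₁ t₂) (t : ℝ) (ht : t₁ ≤ t)
    (ht' : t ≤ t₂) (a b : ℝ) :
    IntervalIntegrable (fun x : ℝ => G (x + t * Complex.I)) MeasureTheory.volume a b := by
  apply Continuous.intervalIntegrable
  rw [← continuousOn_univ]
  refine h.cont.comp (by fun_prop) ?_
  intro x _
  simp [ht, ht']

lemma StripOK.int_v {G : ℂ → ℂ} {t₁ t₂ : ℝ} (h : StripOK G t₁ t₂) (ht : t₁ ≤ t₂) (s : ℝ) :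
    IntervalIntegrable (fun y : ℝ => G (s + y * Complex.I)) MeasureTheory.volume t₁ t₂ := by
  apply ContinuousOn.intervalIntegrable
  refine h.cont.comp (by fun_prop) ?_
  intro x hx
  rw [uIcc_of_le ht] at hx
  simpa using hx

/-- Abstract conservation law in logarithmic coordinates. -/
lemma core_const (β δ : ℝ) (hδ : 0 < δ) (hδβ : δ < β) (hβ : β < π) (c d : ℂ)
    (Fm Fp Hm Hp : ℂ → ℂ)
    (sFp : StripOK Fp (-β) β) (sFm : StripOK Fm β (2 * π - β))
    (sHp : StripOK Hp (-δ) δ) (sHm : StripOK Hm δ (2 * π - δ))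
    (sHm' : StripOK Hm (-(2 * π - δ)) (-δ))
    (pFm : ∀ w, Fm (w + 2 * π * Complex.I) = Fm w)
    (pHm : ∀ w, Hm (w + 2 * π * Complex.I) = Hm w)
    (j1 : ∀ x : ℝ, Fm (x + β * Complex.I) - Fp (x + β * Complex.I)
      = - d * Fp (x + (-δ : ℝ) * Complex.I))
    (j2 : ∀ x : ℝ, Fp (x + (-β : ℝ) * Complex.I) - Fm (x + (-β : ℝ) * Complex.I)
      = c * Fp (x + δ * Complex.I))
    (j3 : ∀ x : ℝ, Hm (x + δ * Complex.I) - Hp (x + δ * Complex.I)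
      = - c * Hm (x + (-β : ℝ) * Complex.I))
    (j4 : ∀ x : ℝ, Hp (x + (-δ : ℝ) * Complex.I) - Hm (x + (-δ : ℝ) * Complex.I)
      = d * Hm (x + β * Complex.I))
    (Ψ : ℂ → ℂ)
    (pΨ : ∀ w, Ψ (w + 2 * π * Complex.I) = Ψ w)
    (e1 : ∀ w : ℂ, -β < w.im → w.im < -δ → Ψ w = Hm w * Fp w)
    (e2 : ∀ w : ℂ, -δ < w.im → w.im < δ → Ψ w = Hp w * Fp w)
    (e3 : ∀ w : ℂ, δ < w.im → w.im < β → Ψ w = Hm w * Fp w)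
    (e4 : ∀ w : ℂ, β < w.im → w.im < 2 * π - β → Ψ w = Hm w * Fm w) :
    (∀ s : ℝ, IntervalIntegrable (fun t : ℝ => Ψ (s + t * Complex.I))
      MeasureTheory.volume (-π) π) ∧
    ∀ a b : ℝ, (∫ t in (-π)..π, Ψ (b + t * Complex.I)) =
      ∫ t in (-π)..π, Ψ (a + t * Complex.I) := by
  have s1 : StripOK (fun w => Hm w * Fp w) (-β) (-δ) :=
    (sHm'.mono (by linarith) le_rfl).mul (sFp.mono le_rfl (by linarith))
  have s2 : StripOK (fun w => Hp w * Fp w) (-δ) δ :=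
    sHp.mul (sFp.mono (by linarith) (by linarith))
  have s3 : StripOK (fun w => Hm w * Fp w) δ β :=
    (sHm.mono le_rfl (by linarith)).mul (sFp.mono (by linarith) le_rfl)
  have s4 : StripOK (fun w => Hm w * Fm w) β (2 * π - β) :=
    (sHm.mono (by linarith) (by linarith)).mul sFm
  have l1 : -β ≤ -δ := by linarith
  have l2 : -δ ≤ δ := by linarith
  have l3 : δ ≤ β := by linarith
  have l4 : β ≤ 2 * π - β := by linarith
  have q1 : ∀ s : ℝ, EqOn (fun t : ℝ => Hm (s + t * Complex.I) * Fp (s + t * Complex.I))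
      (fun t : ℝ => Ψ (s + t * Complex.I)) (uIoo (-β) (-δ)) := by
    intro s t ht
    rw [uIoo_of_le l1] at ht
    exact (e1 _ (by simpa using ht.1) (by simpa using ht.2)).symm
  have q2 : ∀ s : ℝ, EqOn (fun t : ℝ => Hp (s + t * Complex.I) * Fp (s + t * Complex.I))
      (fun t : ℝ => Ψ (s + t * Complex.I)) (uIoo (-δ) δ) := by
    intro s t ht
    rw [uIoo_of_le l2] at ht
    exact (e2 _ (by simpa using ht.1) (by simpa using ht.2)).symm
  have q3 : ∀ s : ℝ, EqOn (fun t : ℝ => Hm (s + t * Complex.I) * Fp (s + t * Complex.I))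
      (fun t : ℝ => Ψ (s + t * Complex.I)) (uIoo δ β) := by
    intro s t ht
    rw [uIoo_of_le l3] at ht
    exact (e3 _ (by simpa using ht.1) (by simpa using ht.2)).symm
  have q4 : ∀ s : ℝ, EqOn (fun t : ℝ => Hm (s + t * Complex.I) * Fm (s + t * Complex.I))
      (fun t : ℝ => Ψ (s + t * Complex.I)) (uIoo β (2 * π - β)) := by
    intro s t ht
    rw [uIoo_of_le l4] at ht
    exact (e4 _ (by simpa using ht.1) (by simpa using ht.2)).symm
  have i1 := fun s : ℝ => (s1.int_v l1 s).congr_uIoo (q1 s)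
  have i2 := fun s : ℝ => (s2.int_v l2 s).congr_uIoo (q2 s)
  have i3 := fun s : ℝ => (s3.int_v l3 s).congr_uIoo (q3 s)
  have i4 := fun s : ℝ => (s4.int_v l4 s).congr_uIoo (q4 s)
  have per : ∀ s : ℝ, Function.Periodic (fun t : ℝ => Ψ (s + t * Complex.I)) (2 * π) := by
    intro s t
    have := pΨ (s + t * Complex.I)
    simp only
    rw [← this]
    congr 1
    push_cast
    ring
  have hper : ∀ s : ℝ, (∫ t in (-π)..π, Ψ (s + t * Complex.I)) =
      ∫ t in (-β)..(2 * π - β), Ψ (s + t * Complex.I) := by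
    intro s
    have := (per s).intervalIntegral_add_eq (-π) (-β)
    have e1 : -π + 2 * π = π := by ring
    have e2 : -β + 2 * π = 2 * π - β := by ring
    rwa [e1, e2] at this
  have hsplit : ∀ s : ℝ, (∫ t in (-π)..π, Ψ (s + t * Complex.I)) =
      (∫ t in (-β)..(-δ), Hm (s + t * Complex.I) * Fp (s + t * Complex.I))
      + (∫ t in (-δ)..δ, Hp (s + t * Complex.I) * Fp (s + t * Complex.I))
      + (∫ t in δ..β, Hm (s + t * Complex.I) * Fp (s + t * Complex.I))
      + (∫ t in β..(2 * π - β), Hm (s + t * Complex.I) * Fm (s + t * Complex.I)) := by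
    intro s
    rw [hper s, ← intervalIntegral.integral_add_adjacent_intervals
        (((i1 s).trans (i2 s)).trans (i3 s)) (i4 s),
      ← intervalIntegral.integral_add_adjacent_intervals ((i1 s).trans (i2 s)) (i3 s),
      ← intervalIntegral.integral_add_adjacent_intervals (i1 s) (i2 s),
      intervalIntegral.integral_congr_uIoo (q1 s), intervalIntegral.integral_congr_uIoo (q2 s),
      intervalIntegral.integral_congr_uIoo (q3 s), intervalIntegral.integral_congr_uIoo (q4 s)]
  refine ⟨fun s => ?_, fun a b => ?_⟩
  · refine (per s).intervalIntegrable (by positivity) (t := -β) ?_ _ _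
    have e2 : -β + 2 * π = 2 * π - β := by ring
    rw [e2]
    exact (((i1 s).trans (i2 s)).trans (i3 s)).trans (i4 s)
  · rw [hsplit a, hsplit b]
    have r1 := s1.rect l1 a b
    have r2 := s2.rect l2 a b
    have r3 := s3.rect l3 a b
    have r4 := s4.rect l4 a b
    have k1 : (∫ x in a..b, Hm (x + (-δ : ℝ) * Complex.I) * Fp (x + (-δ : ℝ) * Complex.I))
        - (∫ x in a..b, Hp (x + (-δ : ℝ) * Complex.I) * Fp (x + (-δ : ℝ) * Complex.I))
        + (∫ x in a..b, Hm (x + β * Complex.I) * Fp (x + β * Complex.I))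
        - (∫ x in a..b, Hm (x + β * Complex.I) * Fm (x + β * Complex.I)) = 0 := by
      rw [← intervalIntegral.integral_sub (s1.int_h _ l1 le_rfl a b)
        (s2.int_h _ le_rfl l2 a b), add_sub_assoc, ← intervalIntegral.integral_sub
        (s3.int_h _ l3 le_rfl a b) (s4.int_h _ le_rfl l4 a b),
        ← intervalIntegral.integral_add
          ((s1.int_h _ l1 le_rfl a b).sub (s2.int_h _ le_rfl l2 a b))
          ((s3.int_h _ l3 le_rfl a b).sub (s4.int_h _ le_rfl l4 a b))]
      rw [← intervalIntegral.integral_zero (a := a) (b := b)]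
      congr 1
      funext x
      linear_combination (- Fp (x + (-δ : ℝ) * Complex.I)) * j4 x
        - Hm (x + β * Complex.I) * j1 x
    have k2' : (fun x : ℝ => Hm (x + (2 * π - β : ℝ) * Complex.I) *
          Fm (x + (2 * π - β : ℝ) * Complex.I))
        = fun x : ℝ => Hm (x + (-β : ℝ) * Complex.I) * Fm (x + (-β : ℝ) * Complex.I) := by
      funext x
      rw [← pHm (x + (-β : ℝ) * Complex.I), ← pFm (x + (-β : ℝ) * Complex.I)]
      have : (x : ℂ) + (2 * π - β : ℝ) * Complex.I
          = x + (-β : ℝ) * Complex.I + 2 * π * Complex.I := by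
        push_cast; ring
      rw [this]
    have i5 := s4.int_h _ l4 le_rfl a b
    rw [k2'] at i5
    have k2 : (∫ x in a..b, Hp (x + δ * Complex.I) * Fp (x + δ * Complex.I))
        - (∫ x in a..b, Hm (x + δ * Complex.I) * Fp (x + δ * Complex.I))
        + (∫ x in a..b, Hm (x + (-β : ℝ) * Complex.I) * Fm (x + (-β : ℝ) * Complex.I))
        - (∫ x in a..b, Hm (x + (-β : ℝ) * Complex.I) * Fp (x + (-β : ℝ) * Complex.I)) = 0 := by
      rw [← intervalIntegral.integral_sub (s2.int_h _ l2 le_rfl a b)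
        (s3.int_h _ le_rfl l3 a b), add_sub_assoc, ← intervalIntegral.integral_sub
        i5 (s1.int_h _ le_rfl l1 a b),
        ← intervalIntegral.integral_add
          ((s2.int_h _ l2 le_rfl a b).sub (s3.int_h _ le_rfl l3 a b))
          (i5.sub (s1.int_h _ le_rfl l1 a b))]
      rw [← intervalIntegral.integral_zero (a := a) (b := b)]
      congr 1
      funext x
      linear_combination (- Fp (x + δ * Complex.I)) * j3 x
        - Hm (x + (-β : ℝ) * Complex.I) * j2 x
    rw [k2'] at r4
    apply mul_left_cancel₀ Complex.I_ne_zero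
    linear_combination r1 + r2 + r3 + r4 + k1 + k2

lemma arg_exp_eq (w : ℂ) (h1 : -π < w.im) (h2 : w.im ≤ π) : (Complex.exp w).arg = w.im := by
  rw [← Complex.log_im, Complex.log_exp h1 h2]

lemma exp_sub_pi (w : ℂ) : -Complex.exp w = Complex.exp (w - π * Complex.I) := by
  rw [Complex.exp_sub, Complex.exp_pi_mul_I]; rw [div_neg, div_one]

lemma exp_add_pi (w : ℂ) : -Complex.exp w = Complex.exp (w + π * Complex.I) := by
  rw [Complex.exp_add, Complex.exp_pi_mul_I]; simp

lemma exp_sub_two_pi (w : ℂ) : Complex.exp w = Complex.exp (w - 2 * π * Complex.I) := by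
  rw [Complex.exp_sub, Complex.exp_two_pi_mul_I]; simp

lemma exp_add_two_pi (w : ℂ) : Complex.exp w = Complex.exp (w + 2 * π * Complex.I) := by
  rw [Complex.exp_add, Complex.exp_two_pi_mul_I]; simp

lemma arg_neg_exp_eq (w : ℂ) (h1 : 0 < w.im) (h2 : w.im ≤ 2 * π) :
    (-Complex.exp w).arg = w.im - π := by
  rw [exp_sub_pi, arg_exp_eq] <;> simp <;> linarith

lemma arg_neg_exp_eq' (w : ℂ) (h1 : -(2 * π) < w.im) (h2 : w.im ≤ 0) :
    (-Complex.exp w).arg = w.im + π := by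
  rw [exp_add_pi, arg_exp_eq] <;> simp <;> linarith

lemma arg_exp_eq_sub (w : ℂ) (h1 : π < w.im) (h2 : w.im ≤ 3 * π) :
    (Complex.exp w).arg = w.im - 2 * π := by
  rw [exp_sub_two_pi, arg_exp_eq] <;> simp <;> linarith

lemma arg_exp_eq_add (w : ℂ) (h1 : -(3 * π) < w.im) (h2 : w.im ≤ -π) :
    (Complex.exp w).arg = w.im + 2 * π := by
  have := Real.pi_pos
  rcases h2.lt_or_eq with h | h
  · rw [exp_add_two_pi, arg_exp_eq] <;> simp <;> linarith
  · rw [exp_add_two_pi, arg_exp_eq] <;> simp <;> linarith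

lemma strip_of {f : ℂ → ℂ} {S A B : Set ℂ} {t₁ t₂ : ℝ} (ha : AnalyticOnNhd ℂ f S)
    (hc : ContinuousOn f (S ∪ A ∪ B))
    (hS : ∀ w : ℂ, t₁ < w.im → w.im < t₂ → Complex.exp w ∈ S)
    (h1 : ∀ w : ℂ, w.im = t₁ → Complex.exp w ∈ A ∪ B)
    (h2 : ∀ w : ℂ, w.im = t₂ → Complex.exp w ∈ A ∪ B) :
    StripOK (fun w => f (Complex.exp w)) t₁ t₂ := by
  constructor
  · refine hc.comp (by fun_prop) ?_
    intro w hw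
    rw [union_assoc]
    rcases hw.1.eq_or_lt with h | h
    · exact Or.inr (h1 w h.symm)
    rcases hw.2.eq_or_lt with h' | h'
    · exact Or.inr (h2 w h')
    · exact Or.inl (hS w h h')
  · intro w hw hw'
    exact (ha _ (hS w hw hw')).differentiableAt.comp w Complex.differentiableAt_exp

lemma pairing_const
    (θ α γ : ℝ) (hθ : 0 < θ)
    (hγ : 0 < γ) (hγ' : γ < min π (π / θ))
    (fm fp hm hp : ℂ → ℂ)
    (hV : MemV θ α γ ⊤ fm fp) (hH : MemH θ α γ ⊤ hm hp) :
    (∀ r : ℝ, 0 < r → IntervalIntegrable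
      (fun t : ℝ => Hval θ γ hm hp ((r : ℂ) * Complex.exp (t * Complex.I)) *
        Vval θ γ fm fp ((r : ℂ) * Complex.exp (t * Complex.I))) MeasureTheory.volume (-π) π) ∧
    ∀ r r' : ℝ, 0 < r → 0 < r' →
      pairingPhi θ γ fm fp hm hp r = pairingPhi θ γ fm fp hm hp r' := by
  have hpi := Real.pi_pos
  have g1 : γ < π := hγ'.trans_le (min_le_left _ _)
  have g2 : θ * γ < π := by
    have : γ < π / θ := hγ'.trans_le (min_le_right _ _)
    rw [lt_div_iff₀ hθ] at this
    linarith
  obtain ⟨β, hβ⟩ : ∃ β, β = (θ⁻¹ * π + γ) / (1 + θ⁻¹) := ⟨_, rfl⟩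
  obtain ⟨δ, hδ⟩ : ∃ δ, δ = (θ⁻¹ * π - γ) / (1 + θ⁻¹) := ⟨_, rfl⟩
  have b1 : β = (π + θ * γ) / (θ + 1) := by rw [hβ]; field_simp
  have d1 : δ = (π - θ * γ) / (θ + 1) := by rw [hδ]; field_simp
  have b2 : (π - γ) / (1 + θ⁻¹) = π - β := by rw [hβ]; field_simp; ring
  have d2 : (π + γ) / (1 + θ⁻¹) = π - δ := by rw [hδ]; field_simp; ring
  have hθ1 : 0 < θ + 1 := by linarith
  have hδ0 : 0 < δ := by rw [d1]; exact div_pos (by linarith) hθ1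
  have hδβ : δ < β := by
    rw [d1, b1]
    exact div_lt_div_of_pos_right (by nlinarith [mul_pos hθ hγ]) hθ1
  have hβπ : β < π := by rw [b1, div_lt_iff₀ hθ1]; nlinarith
  have hsum : β + δ = 2 * π / (θ + 1) := by rw [b1, d1, ← add_div]; ring
  have hsumC : (2 * π * Complex.I / (θ + 1) : ℂ) = (β + δ) * Complex.I := by
    have : ((β + δ : ℝ) : ℂ) = ((2 * π / (θ + 1) : ℝ) : ℂ) := by rw [hsum]
    push_cast at this
    rw [this]; ring
  have hsumC' : (-2 * π * Complex.I / (θ + 1) : ℂ) = -((β + δ) * Complex.I) := by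
    rw [← hsumC]; ring
  have mSp : ∀ w : ℂ, -β < w.im → w.im < β → Complex.exp w ∈ SpV θ γ ⊤ := by
    intro w h1 h2
    refine ⟨by simp [Complex.norm_exp, Real.exp_pos], ENNReal.ofReal_lt_top, ?_⟩
    rw [← hβ, arg_exp_eq w (by linarith) (by linarith), abs_lt]
    exact ⟨h1, h2⟩
  have mSm : ∀ w : ℂ, β < w.im → w.im < 2 * π - β → Complex.exp w ∈ SmV θ γ ⊤ := by
    intro w h1 h2
    refine ⟨by simp [Complex.norm_exp, Real.exp_pos], ENNReal.ofReal_lt_top, ?_⟩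
    rw [b2, arg_neg_exp_eq w (by linarith) (by linarith), abs_lt]
    exact ⟨by linarith, by linarith⟩
  have mHp : ∀ w : ℂ, -δ < w.im → w.im < δ → Complex.exp w ∈ HpS θ γ ⊤ := by
    intro w h1 h2
    refine ⟨by simp [Complex.norm_exp, Real.exp_pos], ENNReal.ofReal_lt_top, ?_⟩
    rw [← hδ, arg_exp_eq w (by linarith) (by linarith), abs_lt]
    exact ⟨h1, h2⟩
  have mHm : ∀ w : ℂ, δ < w.im → w.im < 2 * π - δ → Complex.exp w ∈ HmS θ γ ⊤ := by
    intro w h1 h2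
    refine ⟨by simp [Complex.norm_exp, Real.exp_pos], ENNReal.ofReal_lt_top, ?_⟩
    rw [d2, arg_neg_exp_eq w (by linarith) (by linarith), abs_lt]
    exact ⟨by linarith, by linarith⟩
  have mHm' : ∀ w : ℂ, -(2 * π - δ) < w.im → w.im < -δ → Complex.exp w ∈ HmS θ γ ⊤ := by
    intro w h1 h2
    refine ⟨by simp [Complex.norm_exp, Real.exp_pos], ENNReal.ofReal_lt_top, ?_⟩
    rw [d2, arg_neg_exp_eq' w (by linarith) (by linarith), abs_lt]
    exact ⟨by linarith, by linarith⟩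
  have rVp : ∀ w : ℂ, w.im = β → Complex.exp w ∈ rayPlusV θ γ ⊤ := by
    intro w h
    refine ⟨by simp [Complex.norm_exp, Real.exp_pos], ENNReal.ofReal_lt_top, ?_⟩
    rw [← hβ, arg_exp_eq w (by linarith) (by linarith), h]
  have rVm : ∀ w : ℂ, w.im = -β → Complex.exp w ∈ rayMinusV θ γ ⊤ := by
    intro w h
    refine ⟨by simp [Complex.norm_exp, Real.exp_pos], ENNReal.ofReal_lt_top, ?_⟩
    rw [← hβ, arg_exp_eq w (by linarith) (by linarith), h]
  have rVm' : ∀ w : ℂ, w.im = 2 * π - β → Complex.exp w ∈ rayMinusV θ γ ⊤ := by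
    intro w h
    rw [exp_sub_two_pi]
    exact rVm _ (by simp [h])
  have rHp : ∀ w : ℂ, w.im = δ → Complex.exp w ∈ rayPlusH θ γ ⊤ := by
    intro w h
    refine ⟨by simp [Complex.norm_exp, Real.exp_pos], ENNReal.ofReal_lt_top, ?_⟩
    rw [← hδ, arg_exp_eq w (by linarith) (by linarith), h]
  have rHm : ∀ w : ℂ, w.im = -δ → Complex.exp w ∈ rayMinusH θ γ ⊤ := by
    intro w h
    refine ⟨by simp [Complex.norm_exp, Real.exp_pos], ENNReal.ofReal_lt_top, ?_⟩
    rw [← hδ, arg_exp_eq w (by linarith) (by linarith), h]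
  have rHm' : ∀ w : ℂ, w.im = 2 * π - δ → Complex.exp w ∈ rayMinusH θ γ ⊤ := by
    intro w h
    rw [exp_sub_two_pi]
    exact rHm _ (by simp [h])
  have rHp' : ∀ w : ℂ, w.im = -(2 * π - δ) → Complex.exp w ∈ rayPlusH θ γ ⊤ := by
    intro w h
    rw [exp_add_two_pi]
    exact rHp _ (by simp [h])
  have vp : ∀ w : ℂ, -β < w.im → w.im < β → Vval θ γ fm fp (Complex.exp w)
      = fp (Complex.exp w) := by
    intro w h1 h2
    exact if_pos (mSp w h1 h2).2.2
  have vm : ∀ w : ℂ, β < w.im → w.im < 2 * π - β → Vval θ γ fm fp (Complex.exp w)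
      = fm (Complex.exp w) := by
    intro w h1 h2
    refine if_neg ?_
    rw [← hβ, not_lt]
    rcases le_or_gt w.im π with h | h
    · rw [arg_exp_eq w (by linarith) h]
      exact h1.le.trans (le_abs_self _)
    · rw [arg_exp_eq_sub w h (by linarith)]
      exact le_trans (by linarith) (neg_le_abs _)
  have wp : ∀ w : ℂ, -δ < w.im → w.im < δ → Hval θ γ hm hp (Complex.exp w)
      = hp (Complex.exp w) := by
    intro w h1 h2
    exact if_pos (mHp w h1 h2).2.2
  have wm : ∀ w : ℂ, δ < w.im → w.im < 2 * π - δ → Hval θ γ hm hp (Complex.exp w)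
      = hm (Complex.exp w) := by
    intro w h1 h2
    refine if_neg ?_
    rw [← hδ, not_lt]
    rcases le_or_gt w.im π with h | h
    · rw [arg_exp_eq w (by linarith) h]
      exact h1.le.trans (le_abs_self _)
    · rw [arg_exp_eq_sub w h (by linarith)]
      exact le_trans (by linarith) (neg_le_abs _)
  have wm' : ∀ w : ℂ, -(2 * π - δ) < w.im → w.im < -δ → Hval θ γ hm hp (Complex.exp w)
      = hm (Complex.exp w) := by
    intro w h1 h2
    rw [exp_add_two_pi]
    exact wm _ (by simp; linarith) (by simp; linarith)
  have key := core_const β δ hδ0 hδβ hβπ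
    (Complex.exp ((2 * α + 3) * π * Complex.I / (θ + 1)))
    (Complex.exp (-(2 * α + 3) * π * Complex.I / (θ + 1)))
    (fun w => fm (Complex.exp w)) (fun w => fp (Complex.exp w))
    (fun w => hm (Complex.exp w)) (fun w => hp (Complex.exp w))
    (strip_of hV.anal_p hV.cont_p mSp (fun w h => Or.inr (rVm w h)) (fun w h => Or.inl (rVp w h)))
    (strip_of hV.anal_m hV.cont_m mSm (fun w h => Or.inl (rVp w h)) (fun w h => Or.inr (rVm' w h)))
    (strip_of hH.anal_p hH.cont_p mHp (fun w h => Or.inr (rHm w h)) (fun w h => Or.inl (rHp w h)))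
    (strip_of hH.anal_m hH.cont_m mHm (fun w h => Or.inl (rHp w h)) (fun w h => Or.inr (rHm' w h)))
    (strip_of hH.anal_m hH.cont_m mHm' (fun w h => Or.inl (rHp' w h)) (fun w h => Or.inr (rHm w h)))
    (fun w => by simp only [← exp_add_two_pi]) (fun w => by simp only [← exp_add_two_pi])
    (fun x => by
      rw [hV.jump_plus _ (rVp _ (by simp)), ← Complex.exp_add, hsumC']
      congr 3; push_cast; ring)
    (fun x => by
      rw [hV.jump_minus _ (rVm _ (by simp)), ← Complex.exp_add, hsumC]
      congr 3; push_cast; ring)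
    (fun x => by
      rw [hH.jump_plus _ (rHp _ (by simp)), ← Complex.exp_add, hsumC']
      congr 3; push_cast; ring)
    (fun x => by
      rw [hH.jump_minus _ (rHm _ (by simp)), ← Complex.exp_add, hsumC]
      congr 3; push_cast; ring)
    (fun w => Hval θ γ hm hp (Complex.exp w) * Vval θ γ fm fp (Complex.exp w))
    (fun w => by simp only [← exp_add_two_pi])
    (fun w h1 h2 => by
      rw [wm' w (by linarith) h2, vp w h1 (by linarith)])
    (fun w h1 h2 => by
      rw [wp w h1 h2, vp w (by linarith) (by linarith)])
    (fun w h1 h2 => by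
      rw [wm w h1 (by linarith), vp w (by linarith) h2])
    (fun w h1 h2 => by
      rw [wm w (by linarith) (by linarith), vm w h1 h2])
  have ex : ∀ r : ℝ, 0 < r → ∀ t : ℝ, Complex.exp ((Real.log r : ℝ) + t * Complex.I)
      = r * Complex.exp (t * Complex.I) := by
    intro r hr t
    rw [Complex.exp_add, ← Complex.ofReal_exp, Real.exp_log hr]
  refine ⟨fun r hr => ?_, fun r r' hr hr' => ?_⟩
  · have := key.1 (Real.log r)
    simpa only [ex r hr] using this
  · have := key.2 (Real.log r') (Real.log r)
    simp only [ex r hr, ex r' hr'] at this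
    rw [pairingPhi, pairingPhi, this]

lemma prod_bound (j k : ℕ) (hjk : j ≤ k) (A r : ℝ) (hA : 0 < A) (hr : 1 ≤ r) (z X Y : ℂ)
    (hz : ‖z‖ = r)
    (hX : ‖Complex.exp z * X - z ^ j‖ ≤ A * ‖z‖ ^ ((j : ℝ) - 1))
    (hY : ‖Complex.exp (-z) * Y - z ^ (-(k : ℤ))‖ ≤ A * ‖z‖ ^ (-(k : ℝ) - 1)) :
    ‖Y * X - (if j = k then 1 else 0)‖ ≤ (2 * A + A ^ 2 + 1) / r := by
  have hr0 : 0 < r := by linarith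
  have hz0 : z ≠ 0 := by rintro rfl; simp at hz; linarith
  have hYX : Y * X = (Complex.exp z * X) * (Complex.exp (-z) * Y) := by
    have : Complex.exp z * Complex.exp (-z) = 1 := by rw [← Complex.exp_add]; simp
    linear_combination (-X * Y) * this
  obtain ⟨U, hU⟩ : ∃ U, U = Complex.exp z * X := ⟨_, rfl⟩
  obtain ⟨W, hW⟩ : ∃ W, W = Complex.exp (-z) * Y := ⟨_, rfl⟩
  rw [hYX, ← hU, ← hW]
  rw [← hU, hz, Real.rpow_sub hr0, Real.rpow_natCast, Real.rpow_one] at hX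
  rw [← hW, hz, Real.rpow_sub hr0, Real.rpow_neg hr0.le, Real.rpow_natCast, Real.rpow_one,
    zpow_neg, zpow_natCast] at hY
  obtain ⟨E, hE⟩ : ∃ E, E = U - z ^ j := ⟨_, rfl⟩
  obtain ⟨F, hF⟩ : ∃ F, F = W - (z ^ k)⁻¹ := ⟨_, rfl⟩
  rw [← hE] at hX
  rw [← hF] at hY
  have hUW : U * W = z ^ j * (z ^ k)⁻¹ + z ^ j * F + E * (z ^ k)⁻¹ + E * F := by
    rw [hE, hF]; ring
  have hp : r ^ j * (r ^ k)⁻¹ ≤ 1 := by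
    rw [← div_eq_mul_inv, div_le_one (by positivity)]
    exact pow_le_pow_right₀ hr hjk
  have hrj : 0 < r ^ j := by positivity
  have hrk : 0 < (r ^ k)⁻¹ := by positivity
  have hir : r⁻¹ ≤ 1 := inv_le_one_of_one_le₀ hr
  have hir0 : 0 < r⁻¹ := by positivity
  have n1 : ‖z ^ j * F‖ ≤ A / r := by
    rw [norm_mul, norm_pow, hz]
    calc r ^ j * ‖F‖ ≤ r ^ j * (A * ((r ^ k)⁻¹ / r)) := by gcongr
      _ = (r ^ j * (r ^ k)⁻¹) * (A / r) := by ring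
      _ ≤ 1 * (A / r) := by gcongr
      _ = A / r := one_mul _
  have n2 : ‖E * (z ^ k)⁻¹‖ ≤ A / r := by
    rw [norm_mul, norm_inv, norm_pow, hz]
    calc ‖E‖ * (r ^ k)⁻¹ ≤ (A * (r ^ j / r)) * (r ^ k)⁻¹ := by gcongr
      _ = (r ^ j * (r ^ k)⁻¹) * (A / r) := by ring
      _ ≤ 1 * (A / r) := by gcongr
      _ = A / r := one_mul _
  have n3 : ‖E * F‖ ≤ A ^ 2 / r := by
    rw [norm_mul]
    calc ‖E‖ * ‖F‖ ≤ (A * (r ^ j / r)) * (A * ((r ^ k)⁻¹ / r)) := by gcongr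
      _ = (r ^ j * (r ^ k)⁻¹) * (A ^ 2 / r) * r⁻¹ := by ring
      _ ≤ 1 * (A ^ 2 / r) * 1 := by gcongr
      _ = A ^ 2 / r := by ring
  have n0 : ‖z ^ j * (z ^ k)⁻¹ - (if j = k then 1 else 0)‖ ≤ 1 / r := by
    split_ifs with h
    · subst h
      rw [mul_inv_cancel₀ (pow_ne_zero _ hz0)]
      simp; positivity
    · have hlt : j + 1 ≤ k := by omega
      rw [sub_zero, norm_mul, norm_inv, norm_pow, norm_pow, hz, ← div_eq_mul_inv,
        div_le_div_iff₀ (by positivity) hr0, one_mul, ← pow_succ]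
      exact pow_le_pow_right₀ hr hlt
  rw [hUW]
  calc _ = ‖(z ^ j * (z ^ k)⁻¹ - (if j = k then 1 else 0)) + z ^ j * F + E * (z ^ k)⁻¹
        + E * F‖ := by congr 1; ring
    _ ≤ 1 / r + A / r + A / r + A ^ 2 / r := by
      refine (norm_add_le _ _).trans (add_le_add ((norm_add_le _ _).trans
        (add_le_add ((norm_add_le _ _).trans (add_le_add n0 n1)) n2)) n3)
    _ = _ := by ring

lemma mem_sectors {z : ℂ} (hz : z ≠ 0) {a b : ℝ} (hab : b = π - a) (ha : |z.arg| ≠ a) :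
    |(-z).arg| < b ∨ |z.arg| < a := by
  rcases lt_or_gt_of_ne ha with h | h
  · exact Or.inr h
  left
  rw [hab]
  have hpi := Real.pi_pos
  have e : z = Complex.exp (Complex.log z) := (Complex.exp_log hz).symm
  have hl := Complex.neg_pi_lt_arg z
  have hu := Complex.arg_le_pi z
  rcases le_or_gt z.arg 0 with h0 | h0
  · rw [abs_of_nonpos h0] at h
    have := arg_neg_exp_eq' (Complex.log z) (by rw [Complex.log_im]; linarith)
      (by rw [Complex.log_im]; linarith)
    rw [Complex.exp_log hz, Complex.log_im] at this
    rw [this, abs_lt]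
    constructor <;> linarith
  · rw [abs_of_pos h0] at h
    have := arg_neg_exp_eq (Complex.log z) (by rw [Complex.log_im]; linarith)
      (by rw [Complex.log_im]; linarith)
    rw [Complex.exp_log hz, Complex.log_im] at this
    rw [this, abs_lt]
    constructor <;> linarith

lemma pairing_near (θ γ : ℝ) (fm fp hm hp : ℂ → ℂ) (r ε : ℝ) (D : ℂ)
    (hi : IntervalIntegrable
      (fun t : ℝ => Hval θ γ hm hp ((r : ℂ) * Complex.exp (t * Complex.I)) *
        Vval θ γ fm fp ((r : ℂ) * Complex.exp (t * Complex.I))) MeasureTheory.volume (-π) π)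
    (hb : ∀ᵐ t : ℝ, t ∈ uIoc (-π) π →
      ‖Hval θ γ hm hp ((r : ℂ) * Complex.exp (t * Complex.I)) *
        Vval θ γ fm fp ((r : ℂ) * Complex.exp (t * Complex.I)) - D‖ ≤ ε) :
    ‖pairingPhi θ γ fm fp hm hp r - D‖ ≤ ε := by
  have hpi := Real.pi_pos
  have h := intervalIntegral.norm_integral_le_of_norm_le_const_ae hb
  rw [intervalIntegral.integral_sub hi intervalIntegrable_const,
    intervalIntegral.integral_const] at h
  have e : pairingPhi θ γ fm fp hm hp r - D = ((1 / (2 * π) : ℝ) : ℂ) *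
      ((∫ t in (-π)..π,
      Hval θ γ hm hp ((r : ℂ) * Complex.exp (t * Complex.I)) *
        Vval θ γ fm fp ((r : ℂ) * Complex.exp (t * Complex.I))) - (π - -π) • D) := by
    rw [pairingPhi, mul_sub]
    congr 1
    have : (π : ℂ) ≠ 0 := by exact_mod_cast hpi.ne'
    simp only [Complex.real_smul]
    push_cast
    field_simp
    ring
  rw [e, norm_mul, Complex.norm_real, Real.norm_of_nonneg (by positivity)]
  have e2 : |π - -π| = 2 * π := by rw [abs_of_pos (by linarith)]; ring
  rw [e2] at h
  calc _ ≤ 1 / (2 * π) * (ε * (2 * π)) := by gcongr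
    _ = ε := by field_simp

/-- Evaluation of the pairing for `R = ∞`.
(a) If `e^z f(z) = z^j (1 + O(1/z))` and `e^(-z) h(z) = z^(-k) (1 + O(1/z))` at
infinity on the respective sectors (with `j ≤ k`), then `Φ(R') = δ_{jk}` for every
`R' > 0`.
(b) If `f(z) h(z) → 0` as `z → 0` (equivalently, `sup_{|z|=r} |f h| → 0` as `r → 0⁺`),
then `Φ(R') = 0` for every `R' > 0`. -/
theorem pairing_evaluation
    (θ α γ : ℝ) (hθ : 0 < θ) (hα : -1 < α)
    (hγ : 0 < γ) (hγ' : γ < min π (π / θ))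
    (fm fp hm hp : ℂ → ℂ)
    (hV : MemV θ α γ ⊤ fm fp) (hH : MemH θ α γ ⊤ hm hp) :
    (∀ j k : ℕ, j ≤ k →
      (∃ A > (0:ℝ), ∃ R₀ > (0:ℝ),
        (∀ z ∈ SmV θ γ ⊤ ∪ SpV θ γ ⊤, R₀ ≤ ‖z‖ →
          ‖Complex.exp z * Vval θ γ fm fp z - z ^ j‖ ≤ A * ‖z‖ ^ ((j : ℝ) - 1)) ∧
        (∀ z ∈ HmS θ γ ⊤ ∪ HpS θ γ ⊤, R₀ ≤ ‖z‖ →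
          ‖Complex.exp (-z) * Hval θ γ hm hp z - z ^ (-(k : ℤ))‖ ≤
            A * ‖z‖ ^ (-(k : ℝ) - 1))) →
      ∀ R' : ℝ, 0 < R' →
        (j = k → pairingPhi θ γ fm fp hm hp R' = 1) ∧
        (j < k → pairingPhi θ γ fm fp hm hp R' = 0)) ∧
    ((Tendsto (fun z : ℂ => Vval θ γ fm fp z * Hval θ γ hm hp z)
        (nhdsWithin 0 {(0:ℂ)}ᶜ) (nhds 0)) →
      ∀ R' : ℝ, 0 < R' → pairingPhi θ γ fm fp hm hp R' = 0) := by
  obtain ⟨hint, hconst⟩ := pairing_const θ α γ hθ hγ hγ' fm fp hm hp hV hH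
  have hpi := Real.pi_pos
  have nrm : ∀ r : ℝ, 0 < r → ∀ t : ℝ, ‖(r : ℂ) * Complex.exp (t * Complex.I)‖ = r := by
    intro r hr t
    rw [norm_mul, Complex.norm_exp_ofReal_mul_I, mul_one, Complex.norm_real,
      Real.norm_of_nonneg hr.le]
  have of_le : ∀ (P D : ℂ), (∀ ε > 0, ‖P - D‖ ≤ ε) → P = D := by
    intro P D h
    have : ‖P - D‖ ≤ 0 := le_of_forall_pos_le_add fun ε hε => by simpa using h ε hε
    exact sub_eq_zero.mp (norm_le_zero_iff.mp this)
  constructor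
  · rintro j k hjk ⟨A, hA, R₀, hR₀, hf, hh⟩ R' hR'
    have main : pairingPhi θ γ fm fp hm hp R' = if j = k then 1 else 0 := by
      refine of_le _ _ fun ε hε => ?_
      have hC : 0 < 2 * A + A ^ 2 + 1 := by positivity
      obtain ⟨r, hr⟩ : ∃ r, r = max (max 1 R₀) ((2 * A + A ^ 2 + 1) / ε) := ⟨_, rfl⟩
      have r1 : 1 ≤ r := hr ▸ (le_max_left _ _).trans (le_max_left _ _)
      have r2 : R₀ ≤ r := hr ▸ (le_max_right _ _).trans (le_max_left _ _)
      have r3 : (2 * A + A ^ 2 + 1) / ε ≤ r := hr ▸ le_max_right _ _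
      have r0 : 0 < r := by linarith
      rw [hconst R' r hR' r0]
      refine pairing_near _ _ _ _ _ _ _ _ _ (hint r r0) ?_
      filter_upwards [MeasureTheory.volume.ae_ne ((θ⁻¹ * π + γ) / (1 + θ⁻¹)),
        MeasureTheory.volume.ae_ne (-((θ⁻¹ * π + γ) / (1 + θ⁻¹))),
        MeasureTheory.volume.ae_ne ((θ⁻¹ * π - γ) / (1 + θ⁻¹)),
        MeasureTheory.volume.ae_ne (-((θ⁻¹ * π - γ) / (1 + θ⁻¹)))] with t t1 t2 t3 t4 ht
      rw [uIoc_of_le (by linarith)] at ht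
      obtain ⟨z, hz⟩ : ∃ z, z = (r : ℂ) * Complex.exp (t * Complex.I) := ⟨_, rfl⟩
      have hzn : ‖z‖ = r := hz ▸ nrm r r0 t
      have hz0 : z ≠ 0 := by rintro rfl; simp at hzn; linarith
      have hza : z.arg = t := by
        rw [hz, Complex.arg_real_mul _ r0, arg_exp_eq] <;> simp [ht.1, ht.2]
      have hzp : 0 < ‖z‖ := by rw [hzn]; exact r0
      rw [← hz]
      have cV := mem_sectors hz0 (a := (θ⁻¹ * π + γ) / (1 + θ⁻¹)) (b := (π - γ) / (1 + θ⁻¹))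
        (by field_simp; ring) (by
          rw [hza]; intro h
          rcases eq_or_eq_neg_of_abs_eq h with h | h
          exacts [t1 h, t2 h])
      have cH := mem_sectors hz0 (a := (θ⁻¹ * π - γ) / (1 + θ⁻¹)) (b := (π + γ) / (1 + θ⁻¹))
        (by field_simp; ring) (by
          rw [hza]; intro h
          rcases eq_or_eq_neg_of_abs_eq h with h | h
          exacts [t3 h, t4 h])
      have bV := hf z (cV.imp (fun h => ⟨hzp, ENNReal.ofReal_lt_top, h⟩)
        (fun h => ⟨hzp, ENNReal.ofReal_lt_top, h⟩)) (by rw [hzn]; exact r2)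
      have bH := hh z (cH.imp (fun h => ⟨hzp, ENNReal.ofReal_lt_top, h⟩)
        (fun h => ⟨hzp, ENNReal.ofReal_lt_top, h⟩)) (by rw [hzn]; exact r2)
      refine (prod_bound j k hjk A r hA r1 z _ _ hzn bV bH).trans ?_
      rw [div_le_iff₀ r0]
      rw [div_le_iff₀ hε] at r3
      linarith
    rw [main]
    exact ⟨fun h => if_pos h, fun h => if_neg h.ne⟩
  · intro hT R' hR'
    refine of_le _ _ fun ε hε => ?_
    rw [Metric.tendsto_nhdsWithin_nhds] at hT
    obtain ⟨d, hd, H⟩ := hT ε hε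
    have r0 : 0 < d / 2 := by positivity
    rw [hconst R' (d / 2) hR' r0]
    refine pairing_near _ _ _ _ _ _ _ _ _ (hint _ r0) ?_
    refine Filter.Eventually.of_forall fun t _ => ?_
    have hn := nrm (d / 2) r0 t
    obtain ⟨z, hz⟩ : ∃ z, z = ((d / 2 : ℝ) : ℂ) * Complex.exp (t * Complex.I) := ⟨_, rfl⟩
    rw [← hz] at hn ⊢
    have hz0 : z ≠ 0 := by rintro rfl; simp at hn; linarith
    have := H (x := z) hz0 (by rw [dist_zero_right, hn]; linarith)
    rw [dist_zero_right] at this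
    rw [sub_zero, mul_comm]
    exact this.le
end

section
/- Let β > −1 and let f : (0,1] → ℝ be continuous. Suppose there exist C > 0 and t₀ ∈ (0,1] such that |f(t)| ≤ C·t^β for all t ∈ (0, t₀]. Then f is integrable on (0,1), and (1/n)·Σ_{j=1}^{n} f(j/n) → ∫₀¹ f(t) dt as n → ∞. -/
open MeasureTheory Filter

lemma rs_global_bound (β : ℝ) (hβ : -1 < β) (f : ℝ → ℝ)
    (hf : ContinuousOn f (Set.Ioc 0 1))
    (hbound : ∃ C > (0:ℝ), ∃ t₀ ∈ Set.Ioc (0:ℝ) 1,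
      ∀ t ∈ Set.Ioc (0:ℝ) t₀, |f t| ≤ C * t ^ β) :
    ∃ γ : ℝ, -1 < γ ∧ γ ≤ 0 ∧ ∃ K : ℝ, 0 ≤ K ∧ ∀ t ∈ Set.Ioc (0:ℝ) 1, |f t| ≤ K * t ^ γ := by
  obtain ⟨C, hC, t₀, ht₀, hb⟩ := hbound
  obtain ⟨M, hM⟩ := (isCompact_Icc (a := t₀) (b := 1)).exists_bound_of_continuousOn
    (hf.mono fun x hx => ⟨ht₀.1.trans_le hx.1, hx.2⟩)
  refine ⟨min β 0, lt_min hβ (by norm_num), min_le_right _ _, C + |M|, by positivity, ?_⟩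
  intro t ht
  have h0 : 0 ≤ t ^ (min β 0) := Real.rpow_nonneg ht.1.le _
  rcases le_total t t₀ with h | h
  · have h1 := hb t ⟨ht.1, h⟩
    have h2 : t ^ β ≤ t ^ (min β 0) :=
      Real.rpow_le_rpow_of_exponent_ge ht.1 ht.2 (min_le_left _ _)
    nlinarith [mul_le_mul_of_nonneg_left h2 hC.le, mul_nonneg (abs_nonneg M) h0]
  · have h1 := hM t ⟨h, ht.2⟩
    rw [Real.norm_eq_abs] at h1
    have h2 : 1 ≤ t ^ (min β 0) :=
      Real.one_le_rpow_of_pos_of_le_one_of_nonpos ht.1 ht.2 (min_le_right _ _)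
    nlinarith [mul_le_mul_of_nonneg_left h2 (abs_nonneg M), mul_nonneg hC.le h0, le_abs_self M]

lemma rs_step (f : ℝ → ℝ) (n : ℕ) (hn : 0 < n) :
    IntervalIntegrable (fun t => f ((⌈(n:ℝ) * t⌉₊ : ℝ) / n)) volume 0 1 ∧
    ∫ t in (0:ℝ)..1, f ((⌈(n:ℝ) * t⌉₊ : ℝ) / n) =
      (1 / (n : ℝ)) * ∑ j ∈ Finset.Icc 1 n, f ((j : ℝ) / (n : ℝ)) := by
  have hn' : (0:ℝ) < n := by exact_mod_cast hn
  set a : ℕ → ℝ := fun k => (k:ℝ) / n with ha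
  have hle : ∀ k, a k ≤ a (k+1) := fun k => by
    simp only [ha]; gcongr; simp
  have hc : ∀ k, Set.EqOn (fun _ => f (a (k+1))) (fun t => f ((⌈(n:ℝ) * t⌉₊ : ℝ) / n))
      (Set.uIoc (a k) (a (k+1))) := by
    intro k t ht
    rw [Set.uIoc_of_le (hle k)] at ht
    have h1 : ⌈(n:ℝ) * t⌉₊ = k + 1 := by
      rw [Nat.ceil_eq_iff (by omega)]
      have h1 := ht.1
      have h2 := ht.2
      simp only [ha] at h1 h2
      rw [div_lt_iff₀ hn'] at h1
      rw [le_div_iff₀ hn'] at h2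
      constructor
      · simp; linarith
      · linarith
    simp only [ha, h1]
  have hi : ∀ k, IntervalIntegrable (fun t => f ((⌈(n:ℝ) * t⌉₊ : ℝ) / n)) volume (a k) (a (k+1)) :=
    fun k => (intervalIntegrable_const (c := f (a (k+1)))).congr (hc k)
  have a0 : a 0 = 0 := by simp [ha]
  have an : a n = 1 := by simp only [ha]; field_simp
  have hs : ∀ m : ℕ, ∑ j ∈ Finset.Icc 1 m, f (a j) = ∑ k ∈ Finset.range m, f (a (k+1)) := by
    intro m
    induction m with
    | zero => simp
    | succ m ih => rw [Finset.sum_Icc_succ_top (by omega), ih, Finset.sum_range_succ]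
  constructor
  · have := IntervalIntegrable.trans_iterate (a := a) (n := n) (fun k _ => hi k)
    rwa [a0, an] at this
  · have := intervalIntegral.sum_integral_adjacent_intervals (a := a) (n := n) (fun k _ => hi k)
    rw [a0, an] at this
    rw [← this, hs, Finset.mul_sum]
    refine Finset.sum_congr rfl fun k _ => ?_
    rw [← intervalIntegral.integral_congr_ae (Eventually.of_forall (hc k)), intervalIntegral.integral_const, smul_eq_mul]
    congr 1
    simp only [ha]; push_cast; ring

/-- Riemann sums of a continuous function on `(0,1]` dominated near `0` by `C t^β`
with `β > -1` converge to the (improper at `0`) integral: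
`(1/n) Σ_{j=1}^n f(j/n) → ∫₀¹ f(t) dt`. -/
theorem riemann_sum_tendsto_integral_of_power_bound
    (β : ℝ) (hβ : -1 < β) (f : ℝ → ℝ)
    (hf : ContinuousOn f (Set.Ioc 0 1))
    (hbound : ∃ C > (0:ℝ), ∃ t₀ ∈ Set.Ioc (0:ℝ) 1,
      ∀ t ∈ Set.Ioc (0:ℝ) t₀, |f t| ≤ C * t ^ β) :
    IntegrableOn f (Set.Ioo 0 1) volume ∧
    Tendsto (fun n : ℕ => (1 / (n : ℝ)) * ∑ j ∈ Finset.Icc 1 n, f ((j : ℝ) / (n : ℝ)))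
      atTop (nhds (∫ t in Set.Ioo (0:ℝ) 1, f t)) := by
  obtain ⟨γ, hγ, hγ0, K, hK, hb⟩ := rs_global_bound β hβ f hf hbound
  have hg : IntervalIntegrable (fun t : ℝ => K * t ^ γ) volume 0 1 :=
    (intervalIntegral.intervalIntegrable_rpow' hγ).const_mul K
  have hg' : IntegrableOn (fun t : ℝ => K * t ^ γ) (Set.Ioc 0 1) volume :=
    (intervalIntegrable_iff_integrableOn_Ioc_of_le zero_le_one).1 hg
  have hfi : IntegrableOn f (Set.Ioc 0 1) volume := by
    refine Integrable.mono' hg' (hf.aestronglyMeasurable measurableSet_Ioc) ?_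
    filter_upwards [ae_restrict_mem measurableSet_Ioc] with t ht
    exact hb t ht
  refine ⟨hfi.mono_set Set.Ioo_subset_Ioc_self, ?_⟩
  rw [← integral_Ioc_eq_integral_Ioo, ← intervalIntegral.integral_of_le zero_le_one]
  have key : ∀ n : ℕ, 0 < n → ∀ t ∈ Set.Ioc (0:ℝ) 1,
      t ≤ (⌈(n:ℝ) * t⌉₊ : ℝ) / n ∧ (⌈(n:ℝ) * t⌉₊ : ℝ) / n ∈ Set.Ioc (0:ℝ) 1 := by
    intro n hn t ht
    have hn' : (0:ℝ) < n := by exact_mod_cast hn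
    have h1 : t ≤ (⌈(n:ℝ) * t⌉₊ : ℝ) / n := by
      rw [le_div_iff₀ hn']
      linarith [Nat.le_ceil ((n:ℝ) * t)]
    refine ⟨h1, ht.1.trans_le h1, ?_⟩
    rw [div_le_one hn']
    have : ⌈(n:ℝ) * t⌉₊ ≤ n := Nat.ceil_le.2 (by nlinarith [ht.2])
    exact_mod_cast this
  have main : Tendsto (fun n : ℕ => ∫ t in (0:ℝ)..1, f ((⌈(n:ℝ) * t⌉₊ : ℝ) / n)) atTop
      (nhds (∫ t in (0:ℝ)..1, f t)) := by
    refine intervalIntegral.tendsto_integral_filter_of_dominated_convergence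
      (fun t : ℝ => K * t ^ γ) ?_ ?_ hg ?_
    · filter_upwards [eventually_gt_atTop 0] with n hn
      exact (rs_step f n hn).1.aestronglyMeasurable_restrict_uIoc
    · filter_upwards [eventually_gt_atTop 0] with n hn
      refine Eventually.of_forall fun t ht => ?_
      rw [Set.uIoc_of_le zero_le_one] at ht
      obtain ⟨h1, h2⟩ := key n hn t ht
      exact (hb _ h2).trans (mul_le_mul_of_nonneg_left
        (Real.rpow_le_rpow_of_nonpos ht.1 h1 hγ0) hK)
    · refine Eventually.of_forall fun t ht => ?_
      rw [Set.uIoc_of_le zero_le_one] at ht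
      refine (hf t ht).tendsto.comp (tendsto_nhdsWithin_iff.2 ⟨?_, ?_⟩)
      · have := (tendsto_nat_ceil_mul_div_atTop (R := ℝ) ht.1.le).comp
          (tendsto_natCast_atTop_atTop (R := ℝ))
        refine this.congr fun n => ?_
        simp [mul_comm]
      · filter_upwards [eventually_gt_atTop 0] with n hn
        exact (key n hn t ht).2
  refine main.congr' ?_
  filter_upwards [eventually_gt_atTop 0] with n hn
  exact (rs_step f n hn).2
end
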